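/- arXiv:2311.15344 — 12 statements merged into one kernel-verified Lean document; each statement's English description precedes it below -/
import Mathlib

section
/- Let f : ℝ → ℝ be locally absolutely continuous, suppose x ↦ f(x) − x is bounded on ℝ, suppose the a.e. derivative f′ satisfies f′ − 1 ∈ L²(ℝ), and suppose there exists c ≥ 1 such that 1/c ≤ f′(x) ≤ c for almost every x. Then f is a strictly increasing homeomorphism of ℝ onto ℝ, the inverse f⁻¹ is Lipschitz continuous with Lipschitz constant c, the function y ↦ f⁻¹(y) − y is bounded on ℝ, and f⁻¹ is locally absolutely continuous with a.e. derivative g satisfying g − 1 ∈ L²(ℝ). -/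
open MeasureTheory

/-- If `f - id` is bounded, an increment formula for `f` forces local integrability of the density:
otherwise the junk value `0` of the integral makes `f` constant on a half-line. -/
theorem intervalIntegrable_of_sub_id_bounded {f f' : ℝ → ℝ}
    (hderiv : ∀ a b : ℝ, a ≤ b → f b - f a = ∫ x in a..b, f' x)
    (hbd : ∃ M : ℝ, ∀ x : ℝ, |f x - x| ≤ M) {a b : ℝ} (hab : a ≤ b) :
    IntervalIntegrable f' volume a b := by
  obtain ⟨M, hM⟩ := hbd
  by_contra h
  have hconst : ∀ t, b ≤ t → f t = f a := fun t ht => by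
    have h' : ¬ IntervalIntegrable f' volume a t := fun h' => h <| h'.mono_set <| by
      rw [Set.uIcc_of_le hab, Set.uIcc_of_le (hab.trans ht)]
      exact Set.Icc_subset_Icc_right ht
    have := hderiv a t (hab.trans ht)
    rw [intervalIntegral.integral_undef h'] at this
    linarith
  have h1 := hconst (b + (2 * M + 1)) (by linarith [(abs_nonneg _).trans (hM a)])
  have h2 := hconst b le_rfl
  have h3 := abs_le.1 (hM b)
  have h4 := abs_le.1 (hM (b + (2 * M + 1)))
  linarith [h3.2, h4.1]

theorem locallyIntegrable_of_forall_intervalIntegrable {h : ℝ → ℝ}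
    (hh : ∀ a b : ℝ, a ≤ b → IntervalIntegrable h volume a b) : LocallyIntegrable h := fun x =>
  ⟨Set.Icc (x - 1) (x + 1), Icc_mem_nhds (by linarith) (by linarith),
    (intervalIntegrable_iff_integrableOn_Icc_of_le (by linarith)).1
      (hh (x - 1) (x + 1) (by linarith))⟩

theorem ae_hasDerivAt_of_sub_eq_integral {f f' : ℝ → ℝ} (hf' : LocallyIntegrable f')
    (hderiv : ∀ a b : ℝ, a ≤ b → f b - f a = ∫ x in a..b, f' x) :
    ∀ᵐ x, HasDerivAt f (f' x) x := by
  filter_upwards [_root_.LocallyIntegrable.ae_hasDerivAt_integral hf'] with x hx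
  have heq : f = fun x => f 0 + ∫ t in (0 : ℝ)..x, f' t := by
    funext y
    rcases le_total 0 y with hy | hy
    · linarith [hderiv 0 y hy]
    · rw [intervalIntegral.integral_symm]
      linarith [hderiv y 0 hy]
  rw [heq]
  exact (hx 0).const_add _

theorem LipschitzWith.volume_image_eq_zero {K : NNReal} {f : ℝ → ℝ} (hf : LipschitzWith K f)
    {s : Set ℝ} (hs : volume s = 0) : volume (f '' s) = 0 := by
  have h := hf.hausdorffMeasure_image_le zero_le_one s
  rw [hausdorffMeasure_real, hs, mul_zero] at h
  exact le_antisymm h (zero_le)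

theorem LipschitzWith.sub_eq_integral_deriv {K : NNReal} {g : ℝ → ℝ} (hg : LipschitzWith K g)
    (a b : ℝ) : g b - g a = ∫ x in a..b, deriv g x :=
  hg.lipschitzOnWith.absolutelyContinuousOnInterval.integral_deriv_eq_sub.symm

theorem integrable_deriv_inverse_sub_one_sq {f f' g : ℝ → ℝ} {c : ℝ} {K : NNReal} (hc : 0 < c)
    (hf : LipschitzWith K f) (hf' : AEStronglyMeasurable f')
    (hd : ∀ᵐ x, HasDerivAt f (f' x) x) (hb : ∀ᵐ x, 1 / c ≤ f' x)
    (hL2 : Integrable (fun x => (f' x - 1) ^ 2))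
    (hg : Continuous g) (hgf : ∀ x, g (f x) = x) (hfg : ∀ y, f (g y) = y) :
    Integrable (fun y => (deriv g y - 1) ^ 2) := by
  obtain ⟨S, hSsub, hSm, hS0⟩ : ∃ S ⊆ {x | HasDerivAt f (f' x) x ∧ 1 / c ≤ f' x},
      MeasurableSet S ∧ volume Sᶜ = 0 := by
    obtain ⟨t, ht, htm, ht0⟩ := exists_measurable_superset_of_null (ae_iff.1 (hd.and hb))
    refine ⟨tᶜ, fun x hx => ?_, htm.compl, by rwa [compl_compl]⟩
    by_contra h
    exact hx (ht h)
  have hpos : ∀ x ∈ S, 0 < f' x := fun x hx => (one_div_pos.2 hc).trans_le (hSsub hx).2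
  have hg' : ∀ x ∈ S, deriv g (f x) = (f' x)⁻¹ := fun x hx =>
    (HasDerivAt.of_local_left_inverse hg.continuousAt (by rw [hgf]; exact (hSsub hx).1)
      (hpos x hx).ne' (Filter.Eventually.of_forall hfg)).deriv
  have himage : volume (f '' S)ᶜ = 0 := by
    refine measure_mono_null (fun y hy => ?_) (hf.volume_image_eq_zero hS0)
    exact ⟨g y, fun h => hy ⟨g y, h, hfg y⟩, hfg y⟩
  have hres : volume.restrict (f '' S) = volume :=
    Measure.restrict_eq_self_of_ae_mem (mem_ae_iff.2 himage)
  have hinj : Set.InjOn f S := (Function.LeftInverse.injective hgf).injOn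
  rw [← hres]
  refine (integrableOn_image_iff_integrableOn_abs_deriv_smul hSm
    (fun x hx => (hSsub hx).1.hasDerivWithinAt) hinj _).2 ?_
  have hint : IntegrableOn (fun x => (f' x)⁻¹ * (f' x - 1) ^ 2) S := by
    refine Integrable.mono' (hL2.const_mul c).integrableOn
      ((hf'.aemeasurable.inv.aestronglyMeasurable).mul hL2.aestronglyMeasurable).restrict ?_
    refine (ae_restrict_iff' hSm).2 (Filter.Eventually.of_forall fun x hx => ?_)
    have hx0 := hpos x hx
    rw [Real.norm_of_nonneg (by positivity)]
    gcongr
    exact inv_le_of_inv_le₀ hc (by simpa using (hSsub hx).2)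
  refine hint.congr_fun (fun x hx => ?_) hSm
  have hx0 := hpos x hx
  simp only [hg' x hx, abs_of_pos hx0, smul_eq_mul]
  field_simp
  ring

/-- Criterion for relabeling functions: if `f` is locally absolutely continuous
(encoded via its a.e. derivative `f'` and the fundamental theorem of calculus),
`f − id` is bounded, `f′ − 1 ∈ L²(ℝ)`, and `1/c ≤ f′ ≤ c` a.e. for some `c ≥ 1`,
then `f` is a strictly increasing homeomorphism of `ℝ` onto `ℝ`, its inverse `g`
is Lipschitz with constant `c`, `g − id` is bounded, and `g` is locally absolutely
continuous with a.e. derivative `g'` satisfying `g′ − 1 ∈ L²(ℝ)`. -/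
theorem relabeling_criterion (f f' : ℝ → ℝ) (c : ℝ) (hc : 1 ≤ c)
    (hderiv : ∀ a b : ℝ, a ≤ b → f b - f a = ∫ x in a..b, f' x)
    (hbd : ∃ M : ℝ, ∀ x : ℝ, |f x - x| ≤ M)
    (hL2 : Integrable (fun x => (f' x - 1) ^ 2))
    (hder_bd : ∀ᵐ x : ℝ, 1 / c ≤ f' x ∧ f' x ≤ c) :
    StrictMono f ∧ Continuous f ∧ Function.Bijective f ∧
      ∃ g g' : ℝ → ℝ,
        (∀ x : ℝ, g (f x) = x) ∧ (∀ y : ℝ, f (g y) = y) ∧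
        (∀ y₁ y₂ : ℝ, |g y₂ - g y₁| ≤ c * |y₂ - y₁|) ∧
        (∃ M : ℝ, ∀ y : ℝ, |g y - y| ≤ M) ∧
        (∀ a b : ℝ, a ≤ b → g b - g a = ∫ x in a..b, g' x) ∧
        Integrable (fun x => (g' x - 1) ^ 2) := by
  have hc0 : 0 < c := by linarith
  have hii : ∀ a b : ℝ, a ≤ b → IntervalIntegrable f' volume a b := fun a b hab =>
    intervalIntegrable_of_sub_id_bounded hderiv hbd hab
  have hloc := locallyIntegrable_of_forall_intervalIntegrable hii
  have hlow : ∀ a b : ℝ, a ≤ b → (b - a) / c ≤ f b - f a := fun a b hab => by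
    have h := intervalIntegral.integral_mono_ae hab
      (intervalIntegrable_const (c := 1 / c)) (hii a b hab) (hder_bd.mono fun x hx => hx.1)
    rw [intervalIntegral.integral_const, smul_eq_mul, mul_one_div] at h
    rwa [hderiv a b hab]
  have hup : ∀ a b : ℝ, a ≤ b → f b - f a ≤ c * (b - a) := fun a b hab => by
    have h := intervalIntegral.integral_mono_ae hab
      (hii a b hab) (intervalIntegrable_const (c := c)) (hder_bd.mono fun x hx => hx.2)
    rw [intervalIntegral.integral_const, smul_eq_mul, mul_comm] at h
    rwa [hderiv a b hab]
  have hmono : StrictMono f := fun a b hab => by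
    linarith [hlow a b hab.le, div_pos (sub_pos.2 hab) hc0]
  have hlip : LipschitzWith c.toNNReal f := by
    refine LipschitzWith.of_dist_le' fun x y => ?_
    rw [Real.dist_eq, Real.dist_eq]
    rcases le_total x y with h | h
    · rw [abs_sub_comm, abs_sub_comm x, abs_of_nonneg (sub_nonneg.2 h),
        abs_of_nonneg (sub_nonneg.2 (hmono.monotone h))]
      exact hup x y h
    · rw [abs_of_nonneg (sub_nonneg.2 h), abs_of_nonneg (sub_nonneg.2 (hmono.monotone h))]
      exact hup y x h
  obtain ⟨M, hM⟩ := hbd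
  have hsurj : Function.Surjective f := by
    refine hlip.continuous.surjective ?_ ?_
    · exact Filter.tendsto_atTop_mono (fun x => by rw [id]; linarith [(abs_le.1 (hM x)).1])
        (Filter.tendsto_atTop_add_const_right _ (-M) Filter.tendsto_id)
    · exact Filter.tendsto_atBot_mono (fun x => by rw [id]; linarith [(abs_le.1 (hM x)).2])
        (Filter.tendsto_atBot_add_const_right _ M Filter.tendsto_id)
  have hbij : Function.Bijective f := ⟨hmono.injective, hsurj⟩
  obtain ⟨g, hgf, hfg⟩ := Function.bijective_iff_has_inverse.1 hbij
  have hgbd : ∀ y₁ y₂ : ℝ, |g y₂ - g y₁| ≤ c * |y₂ - y₁| := by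
    have key : ∀ a b : ℝ, a ≤ b → |b - a| ≤ c * |f b - f a| := fun a b hab => by
      rw [abs_of_nonneg (sub_nonneg.2 hab), abs_of_nonneg (sub_nonneg.2 (hmono.monotone hab))]
      exact (div_le_iff₀' hc0).1 (hlow a b hab)
    intro y₁ y₂
    rcases le_total (g y₁) (g y₂) with h | h
    · simpa only [hfg y₁, hfg y₂] using key _ _ h
    · rw [abs_sub_comm, abs_sub_comm y₂]
      simpa only [hfg y₁, hfg y₂] using key _ _ h
  have hglip : LipschitzWith c.toNNReal g :=
    LipschitzWith.of_dist_le' fun x y => by simpa only [Real.dist_eq] using hgbd y x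
  refine ⟨hmono, hlip.continuous, hbij, g, deriv g, hgf, hfg, hgbd, ⟨M, fun y => ?_⟩,
    fun a b _ => hglip.sub_eq_integral_deriv a b, ?_⟩
  · have h := hM (g y)
    rwa [hfg, abs_sub_comm] at h
  · exact integrable_deriv_inverse_sub_one_sq hc0 hlip hloc.aestronglyMeasurable
      (ae_hasDerivAt_of_sub_eq_integral hloc hderiv) (hder_bd.mono fun x hx => hx.1) hL2
      hglip.continuous hgf hfg
end

section
/- Let T > 0, C ≥ 0, and let f : [0, T] × ℝ → ℝ satisfy |f(t, x) − f(t, x̃)| ≤ C|x − x̃| for all t ∈ [0, T] and x, x̃ ∈ ℝ. Let ξ₁ ≤ ξ₂ be real numbers and let k₁, k₂ : [0, T] → ℝ be continuous functions such that for i = 1, 2 the map l ↦ f(l, k_i(l)) is integrable on [0, T] and k_i(t) = ξ_i + ∫_0^t f(l, k_i(l)) dl for every t ∈ [0, T]. Then for every t ∈ [0, T], e^{−Ct}(ξ₂ − ξ₁) ≤ k₂(t) − k₁(t) ≤ e^{Ct}(ξ₂ − ξ₁). In particular, solutions of this integral equation are unique for each initial value, and for each t the map ξ ↦ k(t, ξ)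 is strictly increasing. -/
open MeasureTheory

/-- A Gronwall inequality for a continuous function whose increments over an interval are bounded
by `C * (t - s)` times any upper bound of the function on that interval. -/
theorem le_mul_exp_of_increment_le {u : ℝ → ℝ} {a b C : ℝ} (hab : a ≤ b) (hC : 0 ≤ C)
    (hu : ContinuousOn u (Set.Icc a b))
    (h : ∀ s t, a ≤ s → s ≤ t → t ≤ b → ∀ M, (∀ x ∈ Set.Icc s t, u x ≤ M) →
      u t - u s ≤ C * M * (t - s)) :
    u b ≤ u a * Real.exp (C * (b - a)) := by
  have key := le_gronwallBound_of_liminf_deriv_right_le (f := u) (f' := fun x => C * u x)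
    (δ := u a) (K := C) (ε := 0) hu ?_ le_rfl (fun x _ => by simp) b ⟨hab, le_rfl⟩
  · rwa [gronwallBound_ε0] at key
  intro x hx r hr
  obtain ⟨M, hM, hMr⟩ : ∃ M, u x < M ∧ C * M < r := by
    refine ⟨u x + (r - C * u x) / (C + 1), ?_, ?_⟩
    · have : 0 < (r - C * u x) / (C + 1) := div_pos (by linarith) (by linarith)
      linarith
    · have hd : 0 < (r - C * u x) / (C + 1) := div_pos (by linarith) (by linarith)
      have : (C + 1) * ((r - C * u x) / (C + 1)) = r - C * u x := by field_simp
      linarith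
  have hnear : ∀ᶠ y in nhdsWithin x (Set.Icc a b), u y < M :=
    (hu x ⟨hx.1, hx.2.le⟩).eventually_lt_const hM
  obtain ⟨ε, hε, hball⟩ := Metric.mem_nhdsWithin_iff.1 hnear
  have hright : ∀ᶠ z in nhdsWithin x (Set.Ioi x), z ∈ Set.Ioo x (min b (x + ε)) :=
    Ioo_mem_nhdsGT (lt_min hx.2 (by linarith))
  refine (hright.mono fun z hz => ?_).frequently
  have hzb : z < b := hz.2.trans_le (min_le_left _ _)
  have hzε : z < x + ε := hz.2.trans_le (min_le_right _ _)
  have hinc := h x z hx.1 hz.1.le hzb.le M fun y hy => by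
    have hy' : y ∈ Metric.ball x ε := by
      rw [Metric.mem_ball, Real.dist_eq, abs_lt]
      constructor <;> linarith [hy.1, hy.2]
    exact (hball ⟨hy', hx.1.trans hy.1, hy.2.trans hzb.le⟩ : u y < M).le
  have hpos : 0 < z - x := sub_pos.2 hz.1
  calc (z - x)⁻¹ * (u z - u x) ≤ (z - x)⁻¹ * (C * M * (z - x)) := by gcongr
    _ = C * M := by field_simp
    _ < r := hMr

/-- Forward and backward Gronwall inequalities for a continuous function whose increments, in
absolute value, are bounded by `C * (t - s)` times any upper bound on the interval. -/
theorem le_mul_exp_of_abs_increment_le {u : ℝ → ℝ} {a b C : ℝ} (hab : a ≤ b) (hC : 0 ≤ C)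
    (hu : ContinuousOn u (Set.Icc a b))
    (h : ∀ s t, a ≤ s → s ≤ t → t ≤ b → ∀ M, (∀ x ∈ Set.Icc s t, u x ≤ M) →
      |u t - u s| ≤ C * M * (t - s)) :
    u b ≤ u a * Real.exp (C * (b - a)) ∧ u a ≤ u b * Real.exp (C * (b - a)) := by
  refine ⟨le_mul_exp_of_increment_le hab hC hu fun s t hs hst ht M hM =>
    (le_abs_self _).trans (h s t hs hst ht M hM), ?_⟩
  have hrev := le_mul_exp_of_increment_le (u := fun x => u (a + b - x)) hab hC
    (hu.comp (by fun_prop) fun x hx => ⟨by linarith [hx.2], by linarith [hx.1]⟩)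
    fun s t hs hst ht M hM => by
      have := h (a + b - t) (a + b - s) (by linarith) (by linarith) (by linarith) M
        fun x hx => by
          simpa using hM (a + b - x) ⟨by linarith [hx.2], by linarith [hx.1]⟩
      rw [abs_sub_comm] at this
      linarith [(le_abs_self _).trans this]
  simpa using hrev

/-- Two-sided Gronwall bounds for the change-of-variables flow: if `f(t, ·)` is
`C`-Lipschitz uniformly in `t ∈ [0, T]` and `k₁, k₂` solve the integral equation
`kᵢ(t) = ξᵢ + ∫_0^t f(l, kᵢ(l)) dl` with `ξ₁ ≤ ξ₂`, then
`e^{−Ct}(ξ₂ − ξ₁) ≤ k₂(t) − k₁(t) ≤ e^{Ct}(ξ₂ − ξ₁)` on `[0, T]`. -/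
theorem gronwall_flow_bounds (T C : ℝ) (hT : 0 < T) (hC : 0 ≤ C)
    (f : ℝ → ℝ → ℝ)
    (hLip : ∀ t ∈ Set.Icc (0 : ℝ) T, ∀ x x' : ℝ, |f t x - f t x'| ≤ C * |x - x'|)
    (ξ₁ ξ₂ : ℝ) (hξ : ξ₁ ≤ ξ₂)
    (k₁ k₂ : ℝ → ℝ)
    (hk₁c : ContinuousOn k₁ (Set.Icc 0 T)) (hk₂c : ContinuousOn k₂ (Set.Icc 0 T))
    (hk₁i : IntegrableOn (fun l => f l (k₁ l)) (Set.Icc 0 T))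
    (hk₂i : IntegrableOn (fun l => f l (k₂ l)) (Set.Icc 0 T))
    (hk₁ : ∀ t ∈ Set.Icc (0 : ℝ) T, k₁ t = ξ₁ + ∫ l in (0 : ℝ)..t, f l (k₁ l))
    (hk₂ : ∀ t ∈ Set.Icc (0 : ℝ) T, k₂ t = ξ₂ + ∫ l in (0 : ℝ)..t, f l (k₂ l)) :
    ∀ t ∈ Set.Icc (0 : ℝ) T,
      Real.exp (-(C * t)) * (ξ₂ - ξ₁) ≤ k₂ t - k₁ t ∧
        k₂ t - k₁ t ≤ Real.exp (C * t) * (ξ₂ - ξ₁) := by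
  intro t ht
  set w : ℝ → ℝ := fun x => k₂ x - k₁ x with hw
  have hwc : ContinuousOn w (Set.Icc 0 T) := hk₂c.sub hk₁c
  have h0 : (0 : ℝ) ∈ Set.Icc 0 T := ⟨le_rfl, hT.le⟩
  have hw0 : w 0 = ξ₂ - ξ₁ := by simp [hw, hk₁ 0 h0, hk₂ 0 h0]
  have hint : ∀ {g : ℝ → ℝ}, IntegrableOn g (Set.Icc 0 T) → ∀ s ∈ Set.Icc 0 T,
      ∀ r ∈ Set.Icc 0 T, IntervalIntegrable g volume s r := fun hg s hs r hr =>
    (hg.mono_set (Set.uIcc_subset_Icc hs hr)).intervalIntegrable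
  have hinc : ∀ s r, 0 ≤ s → s ≤ r → r ≤ T → ∀ M, (∀ x ∈ Set.Icc s r, |w x| ≤ M) →
      |(|w r| - |w s|)| ≤ C * M * (r - s) := by
    intro s r hs hsr hr M hM
    have hsT : s ∈ Set.Icc 0 T := ⟨hs, hsr.trans hr⟩
    have hrT : r ∈ Set.Icc 0 T := ⟨hs.trans hsr, hr⟩
    have hdiff : w r - w s = ∫ l in s..r, (f l (k₂ l) - f l (k₁ l)) := by
      rw [intervalIntegral.integral_sub (hint hk₂i s hsT r hrT) (hint hk₁i s hsT r hrT),
        ← intervalIntegral.integral_interval_sub_left (hint hk₂i 0 h0 r hrT)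
          (hint hk₂i 0 h0 s hsT),
        ← intervalIntegral.integral_interval_sub_left (hint hk₁i 0 h0 r hrT)
          (hint hk₁i 0 h0 s hsT)]
      simp only [hw, hk₁ r hrT, hk₁ s hsT, hk₂ r hrT, hk₂ s hsT]
      ring
    refine (abs_abs_sub_abs_le _ _).trans ?_
    rw [hdiff, ← Real.norm_eq_abs, ← abs_of_nonneg (sub_nonneg.2 hsr)]
    refine intervalIntegral.norm_integral_le_of_norm_le_const fun x hx => ?_
    rw [Set.uIoc_of_le hsr] at hx
    exact (hLip x ⟨hs.trans hx.1.le, hx.2.trans hr⟩ _ _).trans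
      (mul_le_mul_of_nonneg_left (hM x ⟨hx.1.le, hx.2⟩) hC)
  have hgron : ∀ s, 0 ≤ s → s ≤ t →
      |w t| ≤ |w s| * Real.exp (C * (t - s)) ∧ |w s| ≤ |w t| * Real.exp (C * (t - s)) :=
    fun s hs hst => le_mul_exp_of_abs_increment_le hst hC
      (hwc.abs.mono (Set.Icc_subset_Icc hs ht.2))
      fun p q hp hpq hq => hinc p q (hs.trans hp) hpq (hq.trans ht.2)
  have hwt : 0 ≤ w t := by
    by_contra! hneg
    obtain ⟨s, hs, hs0⟩ := intermediate_value_Icc' ht.1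
      (hwc.mono (Set.Icc_subset_Icc_right ht.2)) ⟨hneg.le, by rw [hw0]; linarith⟩
    have := (hgron s hs.1 hs.2).1
    rw [hs0, abs_zero, zero_mul] at this
    exact hneg.ne (abs_nonpos_iff.1 this)
  obtain ⟨hup, hlow⟩ := hgron 0 le_rfl ht.1
  rw [hw0, abs_of_nonneg hwt, abs_of_nonneg (sub_nonneg.2 hξ), sub_zero] at hup hlow
  refine ⟨?_, by rwa [mul_comm] at hup⟩
  rw [Real.exp_neg, inv_mul_le_iff₀ (Real.exp_pos _), mul_comm]
  exact hlow
end

section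
/- Let ν be a finite nonnegative Borel measure on ℝ and define y : ℝ → ℝ by y(ζ) = sup{x ∈ ℝ : x + ν((−∞, x)) < ζ}. Then y is well defined with ζ − ν(ℝ) ≤ y(ζ) ≤ ζ for all ζ, and for all ζ₁ ≤ ζ₂ one has 0 ≤ y(ζ₂) − y(ζ₁) ≤ ζ₂ − ζ₁; that is, y is non-decreasing and Lipschitz continuous with Lipschitz constant at most one, and ζ ↦ ζ − y(ζ) is likewise non-decreasing and Lipschitz continuous with Lipschitz constant at most one. -/
open MeasureTheory

section SublevelSet

variable {F : ℝ → ℝ} {M : ℝ}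

theorem mem_sublevel_of_lt (hM : ∀ x, F x ≤ M) {x ζ : ℝ} (hx : x < ζ - M) :
    x ∈ {x : ℝ | x + F x < ζ} := by
  have := hM x
  simp only [Set.mem_ofPred_eq]
  linarith

theorem sublevel_nonempty (hM : ∀ x, F x ≤ M) (ζ : ℝ) : {x : ℝ | x + F x < ζ}.Nonempty :=
  ⟨ζ - M - 1, mem_sublevel_of_lt hM (by linarith)⟩

theorem mem_upperBounds_sublevel (h0 : ∀ x, 0 ≤ F x) (ζ : ℝ) :
    ζ ∈ upperBounds {x : ℝ | x + F x < ζ} := by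
  intro x hx
  have := h0 x
  simp only [Set.mem_ofPred_eq] at hx
  linarith

theorem sub_le_sSup_sublevel (h0 : ∀ x, 0 ≤ F x) (hM : ∀ x, F x ≤ M) (ζ : ℝ) :
    ζ - M ≤ sSup {x : ℝ | x + F x < ζ} :=
  le_of_forall_lt_imp_le_of_dense fun _ hx =>
    le_csSup ⟨ζ, mem_upperBounds_sublevel h0 ζ⟩ (mem_sublevel_of_lt hM hx)

theorem sSup_sublevel_mono (h0 : ∀ x, 0 ≤ F x) (hM : ∀ x, F x ≤ M) {ζ₁ ζ₂ : ℝ} (h : ζ₁ ≤ ζ₂) :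
    sSup {x : ℝ | x + F x < ζ₁} ≤ sSup {x : ℝ | x + F x < ζ₂} :=
  csSup_le_csSup ⟨ζ₂, mem_upperBounds_sublevel h0 ζ₂⟩ (sublevel_nonempty hM ζ₁)
    fun _ hx => lt_of_lt_of_le hx h

theorem sSup_sublevel_le_add (hF : Monotone F) (h0 : ∀ x, 0 ≤ F x) (hM : ∀ x, F x ≤ M)
    {ζ₁ ζ₂ : ℝ} (h : ζ₁ ≤ ζ₂) :
    sSup {x : ℝ | x + F x < ζ₂} ≤ sSup {x : ℝ | x + F x < ζ₁} + (ζ₂ - ζ₁) := by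
  refine csSup_le (sublevel_nonempty hM ζ₂) fun x hx => ?_
  have hshift : x - (ζ₂ - ζ₁) ∈ {x : ℝ | x + F x < ζ₁} := by
    have : F (x - (ζ₂ - ζ₁)) ≤ F x := hF (by linarith)
    simp only [Set.mem_ofPred_eq] at hx ⊢
    linarith
  have := le_csSup ⟨ζ₁, mem_upperBounds_sublevel h0 ζ₁⟩ hshift
  linarith

end SublevelSet

/-- For a finite nonnegative Borel measure `ν` on `ℝ`, the generalized inverse
`y(ζ) = sup{x : x + ν((−∞, x)) < ζ}` is well defined (the set is nonempty and bounded
above), satisfies `ζ − ν(ℝ) ≤ y(ζ) ≤ ζ`, and both `y` and `ζ ↦ ζ − y(ζ)` are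
non-decreasing and Lipschitz with constant one. -/
theorem generalized_inverse_lipschitz (ν : Measure ℝ) [IsFiniteMeasure ν]
    (y : ℝ → ℝ)
    (hy : ∀ ζ : ℝ, y ζ = sSup {x : ℝ | x + (ν (Set.Iio x)).toReal < ζ}) :
    (∀ ζ : ℝ, {x : ℝ | x + (ν (Set.Iio x)).toReal < ζ}.Nonempty ∧
        BddAbove {x : ℝ | x + (ν (Set.Iio x)).toReal < ζ}) ∧
    (∀ ζ : ℝ, ζ - (ν Set.univ).toReal ≤ y ζ ∧ y ζ ≤ ζ) ∧
    (∀ ζ₁ ζ₂ : ℝ, ζ₁ ≤ ζ₂ →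
      (0 ≤ y ζ₂ - y ζ₁ ∧ y ζ₂ - y ζ₁ ≤ ζ₂ - ζ₁) ∧
      (0 ≤ (ζ₂ - y ζ₂) - (ζ₁ - y ζ₁) ∧ (ζ₂ - y ζ₂) - (ζ₁ - y ζ₁) ≤ ζ₂ - ζ₁)) := by
  have hF : Monotone fun x : ℝ => (ν (Set.Iio x)).toReal := fun a b hab =>
    ENNReal.toReal_mono (measure_ne_top ν _) (measure_mono (Set.Iio_subset_Iio hab))
  have h0 : ∀ x : ℝ, 0 ≤ (ν (Set.Iio x)).toReal := fun _ => ENNReal.toReal_nonneg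
  have hM : ∀ x : ℝ, (ν (Set.Iio x)).toReal ≤ (ν Set.univ).toReal := fun _ =>
    ENNReal.toReal_mono (measure_ne_top ν _) (measure_mono (Set.subset_univ _))
  refine ⟨fun ζ => ⟨sublevel_nonempty hM ζ, ζ, mem_upperBounds_sublevel h0 ζ⟩,
    fun ζ => ?_, fun ζ₁ ζ₂ h => ?_⟩
  · rw [hy]
    exact ⟨sub_le_sSup_sublevel h0 hM ζ,
      csSup_le (sublevel_nonempty hM ζ) (mem_upperBounds_sublevel h0 ζ)⟩
  · have hmono := sSup_sublevel_mono h0 hM h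
    have hlip := sSup_sublevel_le_add hF h0 hM h
    rw [← hy, ← hy] at hmono hlip
    refine ⟨⟨?_, ?_⟩, ?_, ?_⟩ <;> linarith
end

section
/- Let u ∈ H¹(ℝ) and let ν be a finite nonnegative Borel measure on ℝ such that (u² + u′²) dx ≤ ν as measures (i.e., ∫_A (u(z)² + u′(z)²) dz ≤ ν(A) for every Borel set A). Define y(ζ) = sup{x ∈ ℝ : x + ν((−∞, x)) < ζ}. Then the composition Ũ = u ∘ y is Lipschitz continuous with Lipschitz constant at most one: |u(y(ζ₂)) − u(y(ζ₁))| ≤ |ζ₂ − ζ₁| for all ζ₁, ζ₂ ∈ ℝ. -/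
open MeasureTheory

open Filter Topology in
/-- If `x + ν((−∞, x)) ≤ c` for all `x < b`, then the inequality also holds at `b`. -/
theorem add_measureReal_Iio_le_of_forall_lt (ν : Measure ℝ) [IsFiniteMeasure ν] {b c : ℝ}
    (h : ∀ x < b, x + ν.real (Set.Iio x) ≤ c) : b + ν.real (Set.Iio b) ≤ c := by
  obtain ⟨s, hs, hlt, hlim⟩ := exists_seq_strictMono_tendsto b
  have hU : ⋃ n, Set.Iio (s n) = Set.Iio b := by
    ext z
    simp only [Set.mem_iUnion, Set.mem_Iio]
    exact ⟨fun ⟨n, hn⟩ => hn.trans (hlt n), fun hz => (hlim.eventually_const_lt hz).exists⟩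
  have hν : Tendsto (fun n => ν (Set.Iio (s n))) atTop (𝓝 (ν (Set.Iio b))) := by
    rw [← hU]
    exact tendsto_measure_iUnion_atTop fun m n hmn => Set.Iio_subset_Iio (hs.monotone hmn)
  exact le_of_tendsto' (hlim.add ((ENNReal.tendsto_toReal (measure_ne_top _ _)).comp hν))
    fun n => h _ (hlt n)

open Filter Topology in
/-- If `c ≤ x + ν((−∞, x))` for all `x > a`, then `c ≤ a + ν((−∞, a])`. -/
theorem le_add_measureReal_Iic_of_forall_gt (ν : Measure ℝ) [IsFiniteMeasure ν] {a c : ℝ}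
    (h : ∀ x > a, c ≤ x + ν.real (Set.Iio x)) : c ≤ a + ν.real (Set.Iic a) := by
  obtain ⟨s, hs, hlt, hlim⟩ := exists_seq_strictAnti_tendsto a
  have hI : ⋂ n, Set.Iio (s n) = Set.Iic a := by
    ext z
    simp only [Set.mem_iInter, Set.mem_Iio, Set.mem_Iic]
    exact ⟨fun hz => ge_of_tendsto' hlim fun n => (hz n).le, fun hz n => hz.trans_lt (hlt n)⟩
  have hν : Tendsto (fun n => ν (Set.Iio (s n))) atTop (𝓝 (ν (Set.Iic a))) := by
    rw [← hI]
    exact tendsto_measure_iInter_atTop (fun n => measurableSet_Iio.nullMeasurableSet)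
      (fun m n hmn => Set.Iio_subset_Iio (hs.antitone hmn)) ⟨0, measure_ne_top _ _⟩
  exact ge_of_tendsto' (hlim.add ((ENNReal.tendsto_toReal (measure_ne_top _ _)).comp hν))
    fun n => h _ (hlt n)

/-- The set defining the generalized inverse of `x ↦ x + ν((−∞, x))` is nonempty. -/
theorem nonempty_add_measureReal_Iio_lt (ν : Measure ℝ) [IsFiniteMeasure ν] (ζ : ℝ) :
    {x : ℝ | x + ν.real (Set.Iio x) < ζ}.Nonempty := by
  refine ⟨ζ - ν.real Set.univ - 1, ?_⟩
  have : ν.real (Set.Iio (ζ - ν.real Set.univ - 1)) ≤ ν.real Set.univ :=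
    measureReal_mono (Set.subset_univ _)
  simp only [Set.mem_ofPred_eq]
  linarith

/-- The set defining the generalized inverse of `x ↦ x + ν((−∞, x))` is bounded above. -/
theorem bddAbove_add_measureReal_Iio_lt (ν : Measure ℝ) (ζ : ℝ) :
    BddAbove {x : ℝ | x + ν.real (Set.Iio x) < ζ} := by
  refine ⟨ζ, fun x hx => ?_⟩
  have : 0 ≤ ν.real (Set.Iio x) := measureReal_nonneg
  simp only [Set.mem_ofPred_eq] at hx
  linarith

/-- The oscillation of `u` over `[a, b]` is at most half of `b - a + ν((a, b))`. -/
theorem abs_sub_le_of_energy_le {u u' : ℝ → ℝ} {ν : Measure ℝ} {a b : ℝ} (hab : a ≤ b)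
    (hderiv : u b - u a = ∫ z in a..b, u' z)
    (hu2 : Integrable (fun z => u z ^ 2))
    (hu'2 : Integrable (fun z => u' z ^ 2))
    (hν : (∫ z in Set.Ioo a b, (u z ^ 2 + u' z ^ 2)) ≤ ν.real (Set.Ioo a b)) :
    |u b - u a| ≤ (b - a + ν.real (Set.Ioo a b)) / 2 := by
  rw [hderiv, intervalIntegral.integral_of_le hab, integral_Ioc_eq_integral_Ioo]
  have hone : IntegrableOn (fun _ : ℝ => (1 : ℝ)) (Set.Ioo a b) := by simp
  have hE : IntegrableOn (fun z => u z ^ 2 + u' z ^ 2) (Set.Ioo a b) :=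
    (hu2.add hu'2).integrableOn
  calc |∫ z in Set.Ioo a b, u' z| ≤ ∫ z in Set.Ioo a b, |u' z| := abs_integral_le_integral_abs
    _ ≤ ∫ z in Set.Ioo a b, (1 + (u z ^ 2 + u' z ^ 2)) / 2 := by
      refine integral_mono_of_nonneg (.of_forall fun z => abs_nonneg _)
        ((hone.add hE).div_const 2) (.of_forall fun z => ?_)
      have := sq_abs (u' z)
      simp only
      nlinarith [sq_nonneg (|u' z| - 1), sq_nonneg (u z)]
    _ = (b - a + ∫ z in Set.Ioo a b, (u z ^ 2 + u' z ^ 2)) / 2 := by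
      rw [integral_div, integral_add hone hE]
      simp [hab]
    _ ≤ _ := by gcongr

/-- For `u ∈ H¹(ℝ)` and a finite nonnegative Borel measure `ν` dominating the energy
density `(u² + u′²) dx`, the composition `u ∘ y` with the generalized inverse
`y(ζ) = sup{x : x + ν((−∞, x)) < ζ}` is Lipschitz with constant one. -/
theorem u_comp_y_lipschitz (u u' : ℝ → ℝ) (ν : Measure ℝ) [IsFiniteMeasure ν]
    (hderiv : ∀ a b : ℝ, a ≤ b → u b - u a = ∫ z in a..b, u' z)
    (hu2 : Integrable (fun z => u z ^ 2))
    (hu'2 : Integrable (fun z => u' z ^ 2))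
    (hν : ∀ A : Set ℝ, MeasurableSet A →
      (∫ z in A, (u z ^ 2 + u' z ^ 2)) ≤ (ν A).toReal)
    (y : ℝ → ℝ)
    (hy : ∀ ζ : ℝ, y ζ = sSup {x : ℝ | x + (ν (Set.Iio x)).toReal < ζ}) :
    ∀ ζ₁ ζ₂ : ℝ, |u (y ζ₂) - u (y ζ₁)| ≤ |ζ₂ - ζ₁| := by
  have hupper (ζ : ℝ) : y ζ + ν.real (Set.Iio (y ζ)) ≤ ζ := by
    refine add_measureReal_Iio_le_of_forall_lt ν fun x hx => ?_
    rw [hy] at hx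
    obtain ⟨w, hw, hxw⟩ := exists_lt_of_lt_csSup (nonempty_add_measureReal_Iio_lt ν ζ) hx
    have : ν.real (Set.Iio x) ≤ ν.real (Set.Iio w) :=
      measureReal_mono (Set.Iio_subset_Iio hxw.le)
    have hw' : w + ν.real (Set.Iio w) < ζ := hw
    linarith
  have hlower (ζ : ℝ) : ζ ≤ y ζ + ν.real (Set.Iic (y ζ)) := by
    refine le_add_measureReal_Iic_of_forall_gt ν fun x hx => ?_
    rw [hy] at hx
    by_contra! hlt
    exact hx.not_ge (le_csSup (bddAbove_add_measureReal_Iio_lt ν ζ) hlt)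
  intro ζ₁ ζ₂
  wlog h : ζ₁ ≤ ζ₂ generalizing ζ₁ ζ₂
  · rw [abs_sub_comm, abs_sub_comm ζ₂]
    exact this ζ₂ ζ₁ (le_of_not_ge h)
  have hmono : y ζ₁ ≤ y ζ₂ := by
    rw [hy, hy]
    exact csSup_le_csSup (bddAbove_add_measureReal_Iio_lt ν ζ₂)
      (nonempty_add_measureReal_Iio_lt ν ζ₁) fun x hx => lt_of_lt_of_le hx h
  rcases hmono.eq_or_lt with heq | hlt
  · simp [heq]
  have hosc := abs_sub_le_of_energy_le hmono (hderiv _ _ hmono) hu2 hu'2 (hν _ measurableSet_Ioo)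
  have hsplit : ν.real (Set.Iio (y ζ₂)) =
      ν.real (Set.Iic (y ζ₁)) + ν.real (Set.Ioo (y ζ₁) (y ζ₂)) := by
    rw [← Set.Iic_union_Ioo_eq_Iio hlt, measureReal_union _ measurableSet_Ioo]
    exact Set.disjoint_left.2 fun z hz hz' => not_lt.2 hz hz'.1
  rw [abs_of_nonneg (sub_nonneg.2 h)]
  linarith [hupper ζ₂, hlower ζ₁]
end

section
/- Let u ∈ H¹(ℝ) and let ν be a finite nonnegative Borel measure on ℝ such that (u² + u′²) dx ≤ ν as measures. Define y(ζ) = sup{x ∈ ℝ : x + ν((−∞, x)) < ζ} and p(x) = (1/4)∫_ℝ e^{−|x−z|}(2u(z)² + u′(z)²) dz. Then the composition P̃ = p ∘ y is Lipschitz continuous with Lipschitz constant at most ν(ℝ): |p(y(ζ₂)) − p(y(ζ₁))| ≤ ν(ℝ)·|ζ₂ − ζ₁| for all ζ₁, ζ₂ ∈ ℝ. -/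
open MeasureTheory

lemma abs_exp_neg_sub_exp_neg_le {a b : ℝ} (ha : 0 ≤ a) (hb : 0 ≤ b) :
    |Real.exp (-a) - Real.exp (-b)| ≤ |a - b| := by
  wlog hab : a ≤ b generalizing a b
  · rw [abs_sub_comm, abs_sub_comm a b]
    exact this hb ha (le_of_not_ge hab)
  have h1 : Real.exp (-b) ≤ Real.exp (-a) := Real.exp_le_exp.2 (by linarith)
  have h2 : Real.exp (-b) = Real.exp (-a) * Real.exp (-(b - a)) := by
    rw [← Real.exp_add]; ring_nf
  have h3 := Real.one_sub_le_exp_neg (b - a)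
  have h4 : Real.exp (-a) ≤ 1 := Real.exp_le_one_iff.2 (by linarith)
  rw [abs_of_nonneg (by linarith), abs_of_nonpos (by linarith)]
  nlinarith [Real.exp_pos (-a)]

/-- Convolution with `e^{-|·|}` maps a nonnegative integrable function to a Lipschitz one. -/
lemma abs_integral_exp_neg_abs_mul_sub_le {f : ℝ → ℝ} (hf : Integrable f) (h0 : ∀ z, 0 ≤ f z)
    (x x' : ℝ) :
    |(∫ z, Real.exp (-|x - z|) * f z) - ∫ z, Real.exp (-|x' - z|) * f z| ≤
      |x - x'| * ∫ z, f z := by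
  have hint (x : ℝ) : Integrable (fun z => Real.exp (-|x - z|) * f z) := by
    refine hf.bdd_mul (c := 1) (by fun_prop) (Filter.Eventually.of_forall fun z => ?_)
    rw [Real.norm_of_nonneg (Real.exp_pos _).le]
    exact Real.exp_le_one_iff.2 (by simp)
  rw [← integral_sub (hint x) (hint x'), ← integral_const_mul, ← Real.norm_eq_abs]
  refine norm_integral_le_of_norm_le (hf.const_mul _) (Filter.Eventually.of_forall fun z => ?_)
  rw [← sub_mul, norm_mul, Real.norm_of_nonneg (h0 z), Real.norm_eq_abs]
  refine mul_le_mul_of_nonneg_right ?_ (h0 z)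
  refine (abs_exp_neg_sub_exp_neg_le (abs_nonneg _) (abs_nonneg _)).trans ?_
  refine (abs_abs_sub_abs_le_abs_sub _ _).trans ?_
  simp

/-- The generalized inverse of `x ↦ x + G x`, with `G` monotone, nonnegative and bounded, is
1-Lipschitz. -/
lemma abs_sSup_add_lt_sub_le {G : ℝ → ℝ} (hG : Monotone G) (h0 : ∀ x, 0 ≤ G x) {M : ℝ}
    (hM : ∀ x, G x ≤ M) (ζ₁ ζ₂ : ℝ) :
    |sSup {x : ℝ | x + G x < ζ₂} - sSup {x : ℝ | x + G x < ζ₁}| ≤ |ζ₂ - ζ₁| := by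
  wlog h : ζ₁ ≤ ζ₂ generalizing ζ₁ ζ₂
  · rw [abs_sub_comm, abs_sub_comm ζ₂ ζ₁]
    exact this ζ₂ ζ₁ (le_of_not_ge h)
  have hne (ζ : ℝ) : {x : ℝ | x + G x < ζ}.Nonempty :=
    ⟨ζ - M - 1, by have := hM (ζ - M - 1); simp only [Set.mem_ofPred_eq]; linarith⟩
  have hbdd (ζ : ℝ) : BddAbove {x : ℝ | x + G x < ζ} :=
    ⟨ζ, fun x hx => by have := h0 x; simp only [Set.mem_ofPred_eq] at hx; linarith⟩
  have h1 : sSup {x : ℝ | x + G x < ζ₁} ≤ sSup {x : ℝ | x + G x < ζ₂} :=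
    csSup_le_csSup (hbdd ζ₂) (hne ζ₁) fun x hx => lt_of_lt_of_le hx h
  have h2 : sSup {x : ℝ | x + G x < ζ₂} ≤ sSup {x : ℝ | x + G x < ζ₁} + (ζ₂ - ζ₁) := by
    refine csSup_le (hne ζ₂) fun x hx => ?_
    have hle : x - (ζ₂ - ζ₁) ≤ sSup {x : ℝ | x + G x < ζ₁} := by
      refine le_csSup (hbdd ζ₁) ?_
      have := hG (show x - (ζ₂ - ζ₁) ≤ x by linarith)
      simp only [Set.mem_ofPred_eq] at hx ⊢
      linarith
    linarith
  rw [abs_of_nonneg (by linarith), abs_of_nonneg (by linarith)]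
  linarith

/-- For `u ∈ H¹(ℝ)` and a finite nonnegative Borel measure `ν` dominating
`(u² + u′²) dx`, the composition `p ∘ y` of the potential
`p(x) = (1/4)∫ e^{−|x−z|}(2u² + u′²) dz` with the generalized inverse
`y(ζ) = sup{x : x + ν((−∞, x)) < ζ}` is Lipschitz with constant `ν(ℝ)`. -/
theorem p_comp_y_lipschitz (u u' : ℝ → ℝ) (ν : Measure ℝ) [IsFiniteMeasure ν]
    (hderiv : ∀ a b : ℝ, a ≤ b → u b - u a = ∫ z in a..b, u' z)
    (hu2 : Integrable (fun z => u z ^ 2))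
    (hu'2 : Integrable (fun z => u' z ^ 2))
    (hν : ∀ A : Set ℝ, MeasurableSet A →
      (∫ z in A, (u z ^ 2 + u' z ^ 2)) ≤ (ν A).toReal)
    (y p : ℝ → ℝ)
    (hy : ∀ ζ : ℝ, y ζ = sSup {x : ℝ | x + (ν (Set.Iio x)).toReal < ζ})
    (hp : ∀ x : ℝ, p x =
      (1 / 4) * ∫ z : ℝ, Real.exp (-|x - z|) * (2 * u z ^ 2 + u' z ^ 2)) :
    ∀ ζ₁ ζ₂ : ℝ, |p (y ζ₂) - p (y ζ₁)| ≤ (ν Set.univ).toReal * |ζ₂ - ζ₁| := by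
  intro ζ₁ ζ₂
  have hy_lip : |y ζ₂ - y ζ₁| ≤ |ζ₂ - ζ₁| := by
    rw [hy, hy]
    exact abs_sSup_add_lt_sub_le (G := fun x => ν.real (Set.Iio x))
      (fun a b hab => measureReal_mono (Set.Iio_subset_Iio hab))
      (fun x => measureReal_nonneg) (M := ν.real Set.univ)
      (fun x => measureReal_mono (Set.subset_univ _)) ζ₁ ζ₂
  have hf : Integrable (fun z => 2 * u z ^ 2 + u' z ^ 2) := (hu2.const_mul 2).add hu'2
  have hmass : ∫ z, (2 * u z ^ 2 + u' z ^ 2) ≤ 2 * (ν Set.univ).toReal := by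
    have h := hν Set.univ MeasurableSet.univ
    rw [setIntegral_univ] at h
    calc ∫ z, (2 * u z ^ 2 + u' z ^ 2) ≤ ∫ z, 2 * (u z ^ 2 + u' z ^ 2) :=
          integral_mono hf ((hu2.add hu'2).const_mul 2)
            fun z => by have := sq_nonneg (u' z); dsimp only; linarith
      _ ≤ 2 * (ν Set.univ).toReal := by rw [integral_const_mul]; linarith
  have hp_lip := abs_integral_exp_neg_abs_mul_sub_le hf (fun z => by positivity) (y ζ₂) (y ζ₁)
  have hν0 : 0 ≤ (ν Set.univ).toReal := ENNReal.toReal_nonneg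
  rw [hp, hp, ← mul_sub, abs_mul, abs_of_pos (by norm_num : (0 : ℝ) < 1 / 4)]
  have h1 := mul_le_mul_of_nonneg_left hmass (abs_nonneg (y ζ₂ - y ζ₁))
  have h2 := mul_le_mul_of_nonneg_right hy_lip hν0
  have h3 := mul_nonneg hν0 (abs_nonneg (ζ₂ - ζ₁))
  linarith
end

section
/- Let u ∈ H¹(ℝ) and let ν be a finite nonnegative Borel measure on ℝ such that (u² + u′²) dx ≤ ν as measures. Define y(ζ) = sup{x ∈ ℝ : x + ν((−∞, x)) < ζ}, p(x) = (1/4)∫_ℝ e^{−|x−z|}(2u(z)² + u′(z)²) dz, Ũ = u ∘ y, and P̃ = p ∘ y. Then the map ζ ↦ Ũ(ζ)³ − 2P̃(ζ)Ũ(ζ) + Ũ(ζ) is Lipschitz continuous on ℝ, with a Lipschitz constant depending only on ν(ℝ). -/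
open MeasureTheory

section LipschitzRHS

variable {u u' : ℝ → ℝ}

/-- If the primitive formula only holds because of a failure of integrability, `u` vanishes. -/
lemma eq_zero_of_not_intervalIntegrable
    (hu : ∀ a b : ℝ, a ≤ b → u b - u a = ∫ z in a..b, u' z)
    (hu2 : Integrable (fun z => u z ^ 2)) {a b : ℝ} (hab : a ≤ b)
    (hn : ¬ IntervalIntegrable u' volume a b) (x : ℝ) : u x = 0 := by
  have key : ∀ c d, c ≤ d → ¬ IntervalIntegrable u' volume c d → u d = u c := by
    intro c d hcd h
    have := hu c d hcd
    rw [intervalIntegral.integral_undef h] at this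
    linarith
  have mono : ∀ c d, c ≤ a → b ≤ d → ¬ IntervalIntegrable u' volume c d := by
    intro c d hc hd h
    refine hn (h.mono_set ?_)
    rw [Set.uIcc_of_le hab, Set.uIcc_of_le (by linarith)]
    exact Set.Icc_subset_Icc hc hd
  have hconst : ∀ x, u x = u a := by
    intro x
    have hba := key a b hab hn
    rcases le_total x a with hx | hx
    · rw [← key x b (hx.trans hab) (mono _ _ hx le_rfl), hba]
    rcases le_total b x with hx' | hx'
    · exact key a x hx (mono _ _ le_rfl hx')
    by_cases h1 : IntervalIntegrable u' volume a x
    · rw [← key x b hx' (fun h2 => hn (h1.trans h2)), hba]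
    · exact key a x hx h1
  have hc : Integrable (fun _ : ℝ => u a ^ 2) := by
    simpa only [hconst] using hu2
  rw [integrable_const_iff] at hc
  rcases hc with hc | hc
  · rw [hconst x]
    exact pow_eq_zero_iff two_ne_zero |>.mp hc
  · exact absurd hc.measure_univ_lt_top (by simp)

lemma abs_sub_le_half_length_add_energy
    (hu : ∀ a b : ℝ, a ≤ b → u b - u a = ∫ z in a..b, u' z)
    (hint : ∀ a b, IntervalIntegrable u' volume a b)
    (hI : Integrable (fun z => u z ^ 2 + u' z ^ 2)) {a b : ℝ} (hab : a ≤ b) :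
    |u b - u a| ≤ ((b - a) + ∫ z in Set.Ico a b, (u z ^ 2 + u' z ^ 2)) / 2 := by
  have hI' : IntervalIntegrable (fun z => u z ^ 2 + u' z ^ 2) volume a b := hI.intervalIntegrable
  calc |u b - u a| = |∫ z in a..b, u' z| := by rw [hu a b hab]
    _ ≤ ∫ z in a..b, |u' z| := intervalIntegral.abs_integral_le_integral_abs hab
    _ ≤ ∫ z in a..b, (1 + (u z ^ 2 + u' z ^ 2)) / 2 := by
        refine intervalIntegral.integral_mono_on hab (hint a b).abs
          ((intervalIntegrable_const.add hI').div_const 2) fun z _ => ?_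
        nlinarith [sq_nonneg (|u' z| - 1), sq_abs (u' z), sq_nonneg (u z)]
    _ = _ := by
        rw [intervalIntegral.integral_div,
          intervalIntegral.integral_add intervalIntegrable_const hI',
          intervalIntegral.integral_of_le hab, intervalIntegral.integral_of_le hab,
          integral_Ico_eq_integral_Ioc]
        simp [hab]

lemma continuous_of_sub_eq_integral
    (hu : ∀ a b : ℝ, a ≤ b → u b - u a = ∫ z in a..b, u' z)
    (hint : ∀ a b, IntervalIntegrable u' volume a b) : Continuous u := by
  have h : u = fun x => u 0 + ∫ z in (0 : ℝ)..x, u' z := by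
    funext x
    rcases le_total 0 x with hx | hx
    · linarith [hu 0 x hx]
    · rw [intervalIntegral.integral_symm]
      linarith [hu x 0 hx]
  rw [h]
  exact continuous_const.add (intervalIntegral.continuous_primitive hint 0)

lemma abs_le_one_add_energy
    (hu : ∀ a b : ℝ, a ≤ b → u b - u a = ∫ z in a..b, u' z)
    (hint : ∀ a b, IntervalIntegrable u' volume a b)
    (hI : Integrable (fun z => u z ^ 2 + u' z ^ 2)) (x : ℝ) :
    |u x| ≤ 1 + ∫ z, (u z ^ 2 + u' z ^ 2) := by
  set E := ∫ z, (u z ^ 2 + u' z ^ 2) with hE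
  have hset : ∀ s : Set ℝ, ∫ z in s, (u z ^ 2 + u' z ^ 2) ≤ E := fun s =>
    setIntegral_le_integral hI (Filter.Eventually.of_forall fun z => by positivity)
  have hpt : ∀ z ∈ Set.Icc x (x + 1),
      |u x| ≤ (1 + (u z ^ 2 + u' z ^ 2)) / 2 + (1 + E) / 2 := by
    intro z hz
    have h1 := abs_sub_le_half_length_add_energy hu hint hI hz.1
    have h2 := hset (Set.Ico x z)
    have h3 : |u x| ≤ |u z| + |u z - u x| := by
      rw [abs_sub_comm]
      linarith [abs_sub_abs_le_abs_sub (u x) (u z)]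
    have h4 := hz.2
    nlinarith [sq_nonneg (|u z| - 1), sq_abs (u z), sq_nonneg (u' z)]
  have hI' : IntervalIntegrable (fun z => u z ^ 2 + u' z ^ 2) volume x (x + 1) :=
    hI.intervalIntegrable
  have hI1 : IntervalIntegrable (fun z => (1 + (u z ^ 2 + u' z ^ 2)) / 2) volume x (x + 1) :=
    (intervalIntegrable_const.add hI').div_const 2
  have hmono := intervalIntegral.integral_mono_on (μ := volume) (by linarith : x ≤ x + 1)
    (intervalIntegrable_const (c := |u x|)) (hI1.add (intervalIntegrable_const (c := (1 + E) / 2)))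
    hpt
  rw [intervalIntegral.integral_add hI1 intervalIntegrable_const, intervalIntegral.integral_div,
    intervalIntegral.integral_add intervalIntegrable_const hI',
    intervalIntegral.integral_of_le (f := fun z => u z ^ 2 + u' z ^ 2)
      (by linarith : x ≤ x + 1)] at hmono
  simp only [intervalIntegral.integral_const, add_sub_cancel_left, one_smul] at hmono
  linarith [hset (Set.Ioc x (x + 1))]

lemma abs_exp_neg_abs_sub_exp_neg_abs_le (s t : ℝ) :
    |Real.exp (-|s|) - Real.exp (-|t|)| ≤ |s - t| := by
  wlog h : |s| ≤ |t| generalizing s t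
  · rw [abs_sub_comm, abs_sub_comm s t]
    exact this t s (le_of_not_ge h)
  have h0 : Real.exp (-|t|) ≤ Real.exp (-|s|) := Real.exp_le_exp.mpr (by linarith)
  rw [abs_of_nonneg (by linarith)]
  have h1 : Real.exp (-|t|) = Real.exp (-|s|) * Real.exp (|s| - |t|) := by
    rw [← Real.exp_add]
    ring_nf
  have h2 := Real.add_one_le_exp (|s| - |t|)
  have h3 : Real.exp (-|s|) ≤ 1 := Real.exp_le_one_iff.mpr (by simp)
  have h4 : |t| - |s| ≤ |s - t| := by
    rw [abs_sub_comm]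
    exact abs_sub_abs_le_abs_sub t s
  rw [h1]
  nlinarith [Real.exp_pos (-|s|)]

lemma integrable_exp_neg_abs_sub_mul {g : ℝ → ℝ} (hg : Integrable g) (x : ℝ) :
    Integrable (fun z => Real.exp (-|x - z|) * g z) := by
  refine hg.bdd_mul (c := 1) (Continuous.aestronglyMeasurable (by fun_prop)) ?_
  refine Filter.Eventually.of_forall fun z => ?_
  rw [Real.norm_of_nonneg (Real.exp_pos _).le]
  exact Real.exp_le_one_iff.mpr (by simp)

lemma abs_integral_exp_neg_abs_sub_mul_le {g : ℝ → ℝ} (hg : Integrable g) (hg0 : ∀ z, 0 ≤ g z)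
    (x : ℝ) : |∫ z, Real.exp (-|x - z|) * g z| ≤ ∫ z, g z := by
  rw [abs_of_nonneg (integral_nonneg fun z => mul_nonneg (Real.exp_pos _).le (hg0 z))]
  refine integral_mono (integrable_exp_neg_abs_sub_mul hg x) hg fun z => ?_
  exact mul_le_of_le_one_left (hg0 z) (Real.exp_le_one_iff.mpr (by simp))

lemma abs_integral_exp_neg_abs_sub_mul_sub_le {g : ℝ → ℝ} (hg : Integrable g)
    (hg0 : ∀ z, 0 ≤ g z) (x w : ℝ) :
    |(∫ z, Real.exp (-|x - z|) * g z) - ∫ z, Real.exp (-|w - z|) * g z| ≤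
      |x - w| * ∫ z, g z := by
  have hx := integrable_exp_neg_abs_sub_mul hg x
  have hw := integrable_exp_neg_abs_sub_mul hg w
  rw [← integral_sub hx hw, ← integral_const_mul]
  refine abs_integral_le_integral_abs.trans (integral_mono (hx.sub hw).abs (hg.const_mul _) ?_)
  intro z
  have h := abs_exp_neg_abs_sub_exp_neg_abs_le (x - z) (w - z)
  rw [sub_sub_sub_cancel_right] at h
  calc |Real.exp (-|x - z|) * g z - Real.exp (-|w - z|) * g z|
      = |Real.exp (-|x - z|) - Real.exp (-|w - z|)| * g z := by
        rw [← sub_mul, abs_mul, abs_of_nonneg (hg0 z)]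
    _ ≤ |x - w| * g z := mul_le_mul_of_nonneg_right h (hg0 z)

/-- Points below the generalized inverse `sSup {x | x + ν (-∞, x) < ζ}` lie in the defining set. -/
lemma add_measure_Iio_lt_of_lt_sSup (ν : Measure ℝ) [IsFiniteMeasure ν] {ζ b : ℝ}
    (hb : b < sSup {x : ℝ | x + (ν (Set.Iio x)).toReal < ζ}) :
    b + (ν (Set.Iio b)).toReal < ζ := by
  have hne : {x : ℝ | x + (ν (Set.Iio x)).toReal < ζ}.Nonempty := by
    refine ⟨ζ - (ν Set.univ).toReal - 1, ?_⟩
    have := ENNReal.toReal_mono (measure_ne_top ν Set.univ)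
      (measure_mono (Set.subset_univ (Set.Iio (ζ - (ν Set.univ).toReal - 1))))
    simp only [Set.mem_ofPred_eq]
    linarith
  obtain ⟨x, hx, hbx⟩ := exists_lt_of_lt_csSup hne hb
  have := ENNReal.toReal_mono (measure_ne_top ν _)
    (measure_mono (Set.Iio_subset_Iio hbx.le))
  simp only [Set.mem_ofPred_eq] at hx
  linarith

lemma le_add_measure_Iio_of_sSup_lt (ν : Measure ℝ) {ζ a : ℝ}
    (ha : sSup {x : ℝ | x + (ν (Set.Iio x)).toReal < ζ} < a) :
    ζ ≤ a + (ν (Set.Iio a)).toReal := by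
  by_contra! h
  refine not_le_of_gt ha (le_csSup ⟨ζ, fun x hx => ?_⟩ h)
  simp only [Set.mem_ofPred_eq] at hx
  linarith [ENNReal.toReal_nonneg (a := ν (Set.Iio x))]

lemma sSup_add_measure_Iio_mono (ν : Measure ℝ) [IsFiniteMeasure ν] {ζ₁ ζ₂ : ℝ} (h : ζ₁ ≤ ζ₂) :
    sSup {x : ℝ | x + (ν (Set.Iio x)).toReal < ζ₁} ≤
      sSup {x : ℝ | x + (ν (Set.Iio x)).toReal < ζ₂} := by
  by_contra! hlt
  obtain ⟨m, hm₂, hm₁⟩ := exists_between hlt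
  linarith [add_measure_Iio_lt_of_lt_sSup ν hm₁, le_add_measure_Iio_of_sSup_lt ν hm₂]

lemma abs_cubic_sub_le {M δ a b p q : ℝ} (hM : 0 ≤ M)
    (ha : |a| ≤ 1 + M) (hb : |b| ≤ 1 + M) (hp : |p| ≤ M)
    (hab : |b - a| ≤ δ) (hpq : |q - p| ≤ M * δ) :
    |(b ^ 3 - 2 * q * b + b) - (a ^ 3 - 2 * p * a + a)| ≤
      (3 * (1 + M) ^ 2 + 2 * M + 1 + 2 * (1 + M) * M) * δ := by
  have hdecomp : (b ^ 3 - 2 * q * b + b) - (a ^ 3 - 2 * p * a + a) =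
      (b ^ 2 + b * a + a ^ 2 - 2 * p + 1) * (b - a) + -(2 * b * (q - p)) := by ring
  have hcoef : |b ^ 2 + b * a + a ^ 2 - 2 * p + 1| ≤ 3 * (1 + M) ^ 2 + 2 * M + 1 := by
    have h1 : |b ^ 2| ≤ (1 + M) ^ 2 := by
      rw [abs_pow]
      gcongr
    have h2 : |a ^ 2| ≤ (1 + M) ^ 2 := by
      rw [abs_pow]
      gcongr
    have h3 : |b * a| ≤ (1 + M) ^ 2 := by
      rw [abs_mul, sq]
      gcongr
    rw [abs_le] at *
    constructor <;> linarith
  have h1 : |(b ^ 2 + b * a + a ^ 2 - 2 * p + 1) * (b - a)| ≤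
      (3 * (1 + M) ^ 2 + 2 * M + 1) * δ := by
    rw [abs_mul]
    gcongr
  have h2 : |-(2 * b * (q - p))| ≤ 2 * (1 + M) * (M * δ) := by
    rw [abs_neg, abs_mul, abs_mul, abs_two]
    gcongr
  rw [hdecomp]
  linarith [abs_add_le ((b ^ 2 + b * a + a ^ 2 - 2 * p + 1) * (b - a)) (-(2 * b * (q - p)))]

end LipschitzRHS

/-- The right-hand side `Ũ³ − 2P̃Ũ + Ũ` of the change-of-variables ODE is Lipschitz
continuous, with a Lipschitz constant depending only on the total mass `ν(ℝ)`:
there is a function `Φ` of the total mass such that for every `u ∈ H¹(ℝ)` and every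
finite measure `ν` dominating `(u² + u′²) dx`, the map
`ζ ↦ (u∘y)(ζ)³ − 2(p∘y)(ζ)(u∘y)(ζ) + (u∘y)(ζ)` is `Φ(ν(ℝ))`-Lipschitz. -/
theorem rhs_lipschitz_const_dep_total_mass :
    ∃ Φ : ℝ → ℝ,
      ∀ (u u' : ℝ → ℝ) (ν : Measure ℝ), IsFiniteMeasure ν →
        (∀ a b : ℝ, a ≤ b → u b - u a = ∫ z in a..b, u' z) →
        Integrable (fun z => u z ^ 2) →
        Integrable (fun z => u' z ^ 2) →
        (∀ A : Set ℝ, MeasurableSet A →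
          (∫ z in A, (u z ^ 2 + u' z ^ 2)) ≤ (ν A).toReal) →
        ∀ y p : ℝ → ℝ,
          (∀ ζ : ℝ, y ζ = sSup {x : ℝ | x + (ν (Set.Iio x)).toReal < ζ}) →
          (∀ x : ℝ, p x =
            (1 / 4) * ∫ z : ℝ, Real.exp (-|x - z|) * (2 * u z ^ 2 + u' z ^ 2)) →
          ∀ ζ₁ ζ₂ : ℝ,
            |(u (y ζ₂) ^ 3 - 2 * p (y ζ₂) * u (y ζ₂) + u (y ζ₂)) -
              (u (y ζ₁) ^ 3 - 2 * p (y ζ₁) * u (y ζ₁) + u (y ζ₁))| ≤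
              Φ ((ν Set.univ).toReal) * |ζ₂ - ζ₁| := by
  refine ⟨fun M => 3 * (1 + M) ^ 2 + 2 * M + 1 + 2 * (1 + M) * M, ?_⟩
  intro u u' ν hν hu hu2 hu'2 hle y p hy hp ζ₁ ζ₂
  set M := (ν Set.univ).toReal with hMdef
  have hM : 0 ≤ M := ENNReal.toReal_nonneg
  by_cases hint : ∀ a b, IntervalIntegrable u' volume a b
  swap
  · have h0 : ∀ x, u x = 0 := by
      push Not at hint
      obtain ⟨a, b, hn⟩ := hint
      rcases le_total a b with h | h
      · exact eq_zero_of_not_intervalIntegrable hu hu2 h hn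
      · exact eq_zero_of_not_intervalIntegrable hu hu2 h fun h' => hn h'.symm
    simp only [h0]
    norm_num
    positivity
  have hI : Integrable (fun z => u z ^ 2 + u' z ^ 2) := hu2.add hu'2
  have hEM : ∫ z, (u z ^ 2 + u' z ^ 2) ≤ M := by
    simpa using hle Set.univ MeasurableSet.univ
  have hub : ∀ x, |u x| ≤ 1 + M := fun x => by
    linarith [abs_le_one_add_energy hu hint hI x]
  have hg : Integrable (fun z => 2 * u z ^ 2 + u' z ^ 2) := (hu2.const_mul 2).add hu'2
  have hg0 : ∀ z, 0 ≤ 2 * u z ^ 2 + u' z ^ 2 := fun z => by positivity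
  have hgM : ∫ z, (2 * u z ^ 2 + u' z ^ 2) ≤ 2 * M := by
    have : ∫ z, (2 * u z ^ 2 + u' z ^ 2) ≤ ∫ z, 2 * (u z ^ 2 + u' z ^ 2) :=
      integral_mono hg (hI.const_mul 2) fun z => by
        simp only
        nlinarith [sq_nonneg (u' z)]
    rw [integral_const_mul] at this
    linarith
  have hpb : ∀ x, |p x| ≤ M := fun x => by
    have := abs_integral_exp_neg_abs_sub_mul_le hg hg0 x
    rw [hp, abs_mul, abs_of_pos (by norm_num : (0 : ℝ) < 1 / 4)]
    linarith
  have hplip : ∀ x w, |p x - p w| ≤ M * |x - w| := fun x w => by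
    have h1 := abs_integral_exp_neg_abs_sub_mul_sub_le hg hg0 x w
    have h2 := mul_le_mul_of_nonneg_left hgM (abs_nonneg (x - w))
    rw [hp, hp, ← mul_sub, abs_mul, abs_of_pos (by norm_num : (0 : ℝ) < 1 / 4)]
    nlinarith [mul_nonneg hM (abs_nonneg (x - w))]
  have huc : Continuous u := continuous_of_sub_eq_integral hu hint
  have hpc : Continuous p :=
    (LipschitzWith.of_dist_le_mul (K := M.toNNReal) fun x w => by
      rw [Real.dist_eq, Real.dist_eq, Real.coe_toNNReal _ hM]
      exact hplip x w).continuous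
  wlog hζ : ζ₁ ≤ ζ₂ generalizing ζ₁ ζ₂
  · rw [abs_sub_comm, abs_sub_comm ζ₂]
    exact this ζ₂ ζ₁ (le_of_not_ge hζ)
  rw [abs_of_nonneg (sub_nonneg.mpr hζ)]
  have hyle : y ζ₁ ≤ y ζ₂ := by
    rw [hy, hy]
    exact sSup_add_measure_Iio_mono ν hζ
  rcases hyle.eq_or_lt with heq | hlt
  · rw [heq, sub_self, abs_zero]
    exact mul_nonneg (by positivity) (sub_nonneg.mpr hζ)
  set F : ℝ → ℝ := fun x => u x ^ 3 - 2 * p x * u x + u x with hF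
  have hFc : Continuous F := by fun_prop
  have hinner : ∀ a ∈ Set.Ioo (y ζ₁) (y ζ₂), ∀ b ∈ Set.Ioo (y ζ₁) (y ζ₂), a ≤ b →
      |F b - F a| ≤
        (3 * (1 + M) ^ 2 + 2 * M + 1 + 2 * (1 + M) * M) * (ζ₂ - ζ₁) := by
    intro a ha b hb hab
    have h1 : ζ₁ ≤ a + (ν (Set.Iio a)).toReal :=
      le_add_measure_Iio_of_sSup_lt ν (by rw [← hy]; exact ha.1)
    have h2 : b + (ν (Set.Iio b)).toReal < ζ₂ :=
      add_measure_Iio_lt_of_lt_sSup ν (by rw [← hy]; exact hb.2)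
    have h3 : (ν (Set.Iio b)).toReal =
        (ν (Set.Iio a)).toReal + (ν (Set.Ico a b)).toReal := by
      rw [← Set.Iio_union_Ico_eq_Iio hab, measure_union _ measurableSet_Ico,
        ENNReal.toReal_add (measure_ne_top _ _) (measure_ne_top _ _)]
      exact Set.disjoint_left.mpr fun x hx hx' => not_le_of_gt hx hx'.1
    have h4 := hle (Set.Ico a b) measurableSet_Ico
    have h5 := abs_sub_le_half_length_add_energy hu hint hI hab
    have h6 : 0 ≤ (ν (Set.Ico a b)).toReal := ENNReal.toReal_nonneg
    have h7 := hplip b a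
    rw [abs_of_nonneg (sub_nonneg.mpr hab)] at h7
    exact abs_cubic_sub_le hM (hub a) (hub b) (hpb a) (by linarith)
      (h7.trans (mul_le_mul_of_nonneg_left (by linarith) hM))
  have hclosed : IsClosed {x : ℝ × ℝ | |F x.2 - F x.1| ≤
      (3 * (1 + M) ^ 2 + 2 * M + 1 + 2 * (1 + M) * M) * (ζ₂ - ζ₁)} :=
    isClosed_le (by fun_prop) continuous_const
  have hsub : Set.Ioo (y ζ₁) (y ζ₂) ×ˢ Set.Ioo (y ζ₁) (y ζ₂) ⊆ {x : ℝ × ℝ | |F x.2 - F x.1| ≤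
      (3 * (1 + M) ^ 2 + 2 * M + 1 + 2 * (1 + M) * M) * (ζ₂ - ζ₁)} := by
    rintro ⟨a, b⟩ ⟨ha, hb⟩
    rcases le_total a b with h | h
    · exact hinner a ha b hb h
    · simp only [Set.mem_ofPred_eq]
      rw [abs_sub_comm]
      exact hinner b hb a ha h
  have hcl := closure_minimal hsub hclosed
  rw [closure_prod_eq, closure_Ioo hlt.ne] at hcl
  exact hcl (show (y ζ₁, y ζ₂) ∈ _ from
    ⟨Set.left_mem_Icc.mpr hlt.le, Set.right_mem_Icc.mpr hlt.le⟩)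
end

section
/- Let T > 0 and C ≥ 0. Suppose y : [0, T] × ℝ → ℝ satisfies: (i) |y(t, ζ) − y(t, η)| ≤ |ζ − η| for all t ∈ [0, T] and ζ, η ∈ ℝ; (ii) there exist U : [0, T] × ℝ → ℝ with |U(t, ζ)| ≤ C for all (t, ζ), and I defined for 0 ≤ t ≤ s ≤ T and x ∈ ℝ with |I(s, t, x)| ≤ C(s − t), such that |y(t, ζ) + U(t, ζ)(s − t) − y(s, ζ + I(s, t, y(t, ζ)) + U(t, ζ)(s − t))| ≤ C(s − t)^{3/2} for all 0 ≤ t ≤ s ≤ T and ζ ∈ ℝ. Then y is jointly Lipschitz continuous on [0, T] × ℝ: there exists a constant C′, depending only on C and T, such that |y(t, ζ) − y(s, η)| ≤ C′(|t − s| + |ζ − η|) for all s, t ∈ [0, T] and ζ, η ∈ ℝ. -/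
open MeasureTheory

theorem rpow_three_halves_le_sqrt_mul {d T : ℝ} (hd : 0 ≤ d) (hdT : d ≤ T) :
    d ^ ((3 : ℝ) / 2) ≤ √T * d := by
  rw [show (3 : ℝ) / 2 = 1 / 2 + 1 by norm_num,
    Real.rpow_add_of_nonneg hd (by norm_num) (by norm_num), Real.rpow_one,
    ← Real.sqrt_eq_rpow]
  exact mul_le_mul_of_nonneg_right (Real.sqrt_le_sqrt hdT) hd

/-- If `y(t, ·)` is `1`-Lipschitz for each `t ∈ [0, T]` and satisfies the approximate
flow estimate with bounded velocity `U` and remainder `I`, then `y` is jointly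
Lipschitz on `[0, T] × ℝ`, with a constant depending only on `C` and `T`. -/
theorem joint_lipschitz_of_approx_flow :
    ∃ Φ : ℝ → ℝ → ℝ,
      ∀ (T C : ℝ), 0 < T → 0 ≤ C →
        ∀ y : ℝ → ℝ → ℝ,
          (∀ t ∈ Set.Icc (0 : ℝ) T, ∀ ζ η : ℝ, |y t ζ - y t η| ≤ |ζ - η|) →
          (∃ (U : ℝ → ℝ → ℝ) (I : ℝ → ℝ → ℝ → ℝ),
            (∀ t ∈ Set.Icc (0 : ℝ) T, ∀ ζ : ℝ, |U t ζ| ≤ C) ∧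
            (∀ s t x : ℝ, 0 ≤ t → t ≤ s → s ≤ T → |I s t x| ≤ C * (s - t)) ∧
            (∀ s t : ℝ, 0 ≤ t → t ≤ s → s ≤ T → ∀ ζ : ℝ,
              |y t ζ + U t ζ * (s - t) -
                  y s (ζ + I s t (y t ζ) + U t ζ * (s - t))| ≤
                C * (s - t) ^ ((3 : ℝ) / 2))) →
          ∀ s ∈ Set.Icc (0 : ℝ) T, ∀ t ∈ Set.Icc (0 : ℝ) T, ∀ ζ η : ℝ,
            |y t ζ - y s η| ≤ Φ C T * (|t - s| + |ζ - η|) := by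
  refine ⟨fun C T => C * √T + 3 * C + 1, ?_⟩
  rintro T C - hC y hlip ⟨U, I, hU, hI, hflow⟩
  have time_lipschitz : ∀ s t : ℝ, 0 ≤ t → t ≤ s → s ≤ T → ∀ ζ : ℝ,
      |y t ζ - y s ζ| ≤ (C * √T + 3 * C) * (s - t) := by
    intro s t ht hts hs ζ
    have hd : 0 ≤ s - t := sub_nonneg.2 hts
    have hflow := hflow s t ht hts hs ζ
    have hI := hI s t (y t ζ) ht hts hs
    have hUd : |U t ζ * (s - t)| ≤ C * (s - t) := by
      rw [abs_mul, abs_of_nonneg hd]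
      exact mul_le_mul_of_nonneg_right (hU t ⟨ht, hts.trans hs⟩ ζ) hd
    have hspace := hlip s ⟨ht.trans hts, hs⟩
      (ζ + I s t (y t ζ) + U t ζ * (s - t)) ζ
    rw [show ζ + I s t (y t ζ) + U t ζ * (s - t) - ζ =
      I s t (y t ζ) + U t ζ * (s - t) by ring] at hspace
    have hsum := abs_add_le (I s t (y t ζ)) (U t ζ * (s - t))
    have hpow := mul_le_mul_of_nonneg_left
      (rpow_three_halves_le_sqrt_mul hd (by linarith : s - t ≤ T)) hC
    obtain ⟨hflow₁, hflow₂⟩ := abs_le.1 hflow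
    obtain ⟨hUd₁, hUd₂⟩ := abs_le.1 hUd
    obtain ⟨hspace₁, hspace₂⟩ := abs_le.1 hspace
    rw [abs_le]
    constructor <;> linarith
  intro s hs t ht ζ η
  have hK : 0 ≤ C * √T + 3 * C := by positivity
  have htime : |y t ζ - y s ζ| ≤ (C * √T + 3 * C) * |t - s| := by
    rcases le_total t s with h | h
    · rw [abs_sub_comm t s, abs_of_nonneg (sub_nonneg.2 h)]
      exact time_lipschitz s t ht.1 h hs.2 ζ
    · rw [abs_sub_comm (y t ζ), abs_of_nonneg (sub_nonneg.2 h)]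
      exact time_lipschitz t s hs.1 h ht.2 ζ
  have hspace := hlip s hs ζ η
  have htri := abs_sub_le (y t ζ) (y s ζ) (y s η)
  have hζη := mul_nonneg hK (abs_nonneg (ζ - η))
  have hts := abs_nonneg (t - s)
  linarith
end

section
/- With the peakon–antipeakon data, for every x ∈ ℝ, u(t, x) → 0 as t → t*⁻. -/
open MeasureTheory Filter

/-- The function `x ↦ exp (-|x|)` is `1`-Lipschitz. -/
theorem Real.abs_exp_neg_abs_sub_le (a b : ℝ) :
    |Real.exp (-|a|) - Real.exp (-|b|)| ≤ |a - b| := by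
  wlog h : |b| ≤ |a| generalizing a b
  · rw [abs_sub_comm, abs_sub_comm a b]
    exact this b a (le_of_not_ge h)
  have hle : Real.exp (-|a|) ≤ Real.exp (-|b|) := Real.exp_le_exp.2 (by linarith)
  rw [abs_sub_comm, abs_of_nonneg (by linarith)]
  have hb : Real.exp (-|b|) ≤ 1 := Real.exp_le_one_iff.2 (by simp)
  have hfac : Real.exp (-|a|) = Real.exp (-|b|) * Real.exp (-(|a| - |b|)) := by
    rw [← Real.exp_add]; congr 1; ring
  have hlin := Real.add_one_le_exp (-(|a| - |b|))
  have htri := abs_sub_abs_le_abs_sub a b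
  nlinarith [Real.exp_pos (-|b|)]

/-- The separation `|log (2s / (1 + s²))|` of the peaks is quadratic in `1 - s`. -/
theorem abs_log_two_mul_div_one_add_sq_le {s : ℝ} (hs : 0 < s) :
    |Real.log (2 * s / (1 + s ^ 2))| ≤ (1 - s) ^ 2 / (2 * s) := by
  have hnonpos : Real.log (2 * s / (1 + s ^ 2)) ≤ 0 :=
    Real.log_nonpos (by positivity)
      ((div_le_one (by positivity)).2 (by nlinarith [sq_nonneg (1 - s)]))
  rw [abs_of_nonpos hnonpos, ← Real.log_inv]
  have hlog := Real.log_le_sub_one_of_pos (x := (2 * s / (1 + s ^ 2))⁻¹) (by positivity)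
  have heq : (2 * s / (1 + s ^ 2))⁻¹ - 1 = (1 - s) ^ 2 / (2 * s) := by
    field_simp
    ring
  exact hlog.trans_eq heq

/-- Peakon–antipeakon: for every `x ∈ ℝ`, `u(t, x) → 0` as `t → t*⁻`. -/
theorem peakon_antipeakon_tendsto_zero (D tstar : ℝ) (hD : 0 < D)
    (p q : ℝ → ℝ) (u : ℝ → ℝ → ℝ)
    (hp : ∀ t < tstar, p t =
      D * (1 + Real.exp (2 * D * (t - tstar))) / (1 - Real.exp (2 * D * (t - tstar))))
    (hq : ∀ t < tstar, q t =
      Real.log (2 * Real.exp (D * (t - tstar)) / (1 + Real.exp (2 * D * (t - tstar)))))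
    (hu : ∀ t < tstar, ∀ x : ℝ,
      u t x = p t * (Real.exp (-|x - q t|) - Real.exp (-|x + q t|))) :
    ∀ x : ℝ, Tendsto (fun t => u t x) (nhdsWithin tstar (Set.Iio tstar)) (nhds 0) := by
  intro x
  have hlim : Tendsto (fun t => D * (1 + Real.exp (D * (t - tstar)) ^ 2) *
      (1 - Real.exp (D * (t - tstar))) /
        (Real.exp (D * (t - tstar)) * (1 + Real.exp (D * (t - tstar)))))
      (nhdsWithin tstar (Set.Iio tstar)) (nhds 0) := by
    have hcont : Continuous (fun t => D * (1 + Real.exp (D * (t - tstar)) ^ 2) *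
        (1 - Real.exp (D * (t - tstar))) /
          (Real.exp (D * (t - tstar)) * (1 + Real.exp (D * (t - tstar))))) :=
      Continuous.div (by fun_prop) (by fun_prop) (fun t => by positivity)
    simpa using (hcont.tendsto tstar).mono_left nhdsWithin_le_nhds
  refine squeeze_zero_norm' ?_ hlim
  filter_upwards [self_mem_nhdsWithin] with t ht
  have ht : t < tstar := ht
  have hsq : Real.exp (2 * D * (t - tstar)) = Real.exp (D * (t - tstar)) ^ 2 := by
    rw [← Real.exp_nat_mul]; congr 1; push_cast; ring
  have hs1 : Real.exp (D * (t - tstar)) < 1 :=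
    Real.exp_lt_one_iff.2 (mul_neg_of_pos_of_neg hD (by linarith))
  have hs0 := Real.exp_pos (D * (t - tstar))
  have hpt := hp t ht
  have hqt := hq t ht
  rw [hsq] at hpt hqt
  generalize Real.exp (D * (t - tstar)) = s at *
  have hs2 : 0 < 1 - s ^ 2 := by nlinarith
  have hppos : 0 ≤ p t := by rw [hpt]; positivity
  have hqle : |q t| ≤ (1 - s) ^ 2 / (2 * s) := by
    rw [hqt]; exact abs_log_two_mul_div_one_add_sq_le hs0
  have hexp := Real.abs_exp_neg_abs_sub_le (x - q t) (x + q t)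
  have hdist : |x - q t - (x + q t)| = 2 * |q t| := by
    rw [show x - q t - (x + q t) = -(2 * q t) by ring, abs_neg, abs_mul, abs_two]
  rw [hu t ht x, Real.norm_eq_abs, abs_mul, abs_of_nonneg hppos]
  calc p t * |Real.exp (-|x - q t|) - Real.exp (-|x + q t|)|
      ≤ p t * (2 * ((1 - s) ^ 2 / (2 * s))) := by gcongr; linarith
    _ = D * (1 + s ^ 2) * (1 - s) / (s * (1 + s)) := by
      have h1 : 1 - s ≠ 0 := by linarith
      have h2 : 1 + s ≠ 0 := by linarith
      rw [hpt, show 1 - s ^ 2 = (1 - s) * (1 + s) by ring]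
      field_simp
end

section
/- With the peakon–antipeakon data, for every t < t* one has ∫_ℝ (u(t, y)² + u_x(t, y)²) dy = 4D², where u_x(t, ·) denotes the almost-everywhere derivative of u(t, ·); i.e., the energy is conserved and equal to 4D² before the blow-up time t*. -/
open MeasureTheory Filter

/-- The energy density of a function that is `A eˣ + B e⁻ˣ` on an open set. -/
lemma energy_density_of_eqOn {s : Set ℝ} (hs : IsOpen s) {v : ℝ → ℝ} {A B x v' : ℝ}
    (hv : ∀ y ∈ s, v y = A * Real.exp y + B * Real.exp (-y)) (hx : x ∈ s)
    (hd : HasDerivAt v v' x) :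
    v x ^ 2 + v' ^ 2 = 2 * A ^ 2 * Real.exp (2 * x) + 2 * B ^ 2 * Real.exp (-2 * x) := by
  have h₁ : HasDerivAt (fun y => A * Real.exp y + B * Real.exp (-y))
      (A * Real.exp x + B * (Real.exp (-x) * (-1))) x :=
    ((Real.hasDerivAt_exp x).const_mul A).add (((hasDerivAt_neg x).exp).const_mul B)
  have h₂ : v =ᶠ[nhds x] fun y => A * Real.exp y + B * Real.exp (-y) := by
    filter_upwards [hs.mem_nhds hx] with y hy using hv y hy
  have h₃ : Real.exp (2 * x) = Real.exp x ^ 2 := by rw [← Real.exp_nat_mul]; norm_num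
  have h₄ : Real.exp (-2 * x) = Real.exp (-x) ^ 2 := by
    rw [← Real.exp_nat_mul]; congr 1; push_cast; ring
  rw [hd.unique (h₁.congr_of_eventuallyEq h₂), hv x hx, h₃, h₄]
  ring

/-- The `H¹` energy of the difference of two peakons of amplitude `c` centred at `-a` and `a`. -/
lemma integral_energy_peakon_sub {a c : ℝ} (ha : 0 < a) {v v' : ℝ → ℝ}
    (hv : ∀ x, v x = c * (Real.exp (-|x + a|) - Real.exp (-|x - a|)))
    (hd : ∀ᵐ x : ℝ, HasDerivAt v (v' x) x) :
    ∫ y : ℝ, (v y ^ 2 + v' y ^ 2) = 4 * c ^ 2 * (1 - Real.exp (-a) ^ 2) := by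
  set m := c * (Real.exp a - Real.exp (-a)) with hm
  set k := c * Real.exp (-a) with hk
  have hleft : ∀ x ∈ Set.Iio (-a), v x = m * Real.exp x + 0 * Real.exp (-x) := by
    intro x hx
    rw [Set.mem_Iio] at hx
    rw [hv, abs_of_neg (by linarith), abs_of_neg (by linarith), hm,
      show -(-(x + a)) = x + a by ring, show -(-(x - a)) = x + -a by ring,
      Real.exp_add, Real.exp_add]
    ring
  have hmid : ∀ x ∈ Set.Ioo (-a) a, v x = (-k) * Real.exp x + k * Real.exp (-x) := by
    rintro x ⟨hx₁, hx₂⟩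
    rw [hv, abs_of_pos (by linarith), abs_of_neg (by linarith), hk,
      show -(x + a) = -x + -a by ring, show -(-(x - a)) = x + -a by ring,
      Real.exp_add, Real.exp_add]
    ring
  have hright : ∀ x ∈ Set.Ioi a, v x = 0 * Real.exp x + (-m) * Real.exp (-x) := by
    intro x hx
    rw [Set.mem_Ioi] at hx
    rw [hv, abs_of_pos (by linarith), abs_of_pos (by linarith), hm,
      show -(x + a) = -x + -a by ring, show -(x - a) = -x + a by ring,
      Real.exp_add, Real.exp_add]
    ring
  have eleft : (fun x => v x ^ 2 + v' x ^ 2) =ᵐ[volume.restrict (Set.Iic (-a))]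
      fun x => 2 * m ^ 2 * Real.exp (2 * x) := by
    refine (ae_restrict_iff' measurableSet_Iic).2 ?_
    filter_upwards [hd, Measure.ae_ne volume (-a)] with x hx hne hmem
    simpa using energy_density_of_eqOn isOpen_Iio hleft (lt_of_le_of_ne hmem hne) hx
  have emid : (fun x => v x ^ 2 + v' x ^ 2) =ᵐ[volume.restrict (Set.Ioc (-a) a)]
      fun x => 2 * k ^ 2 * Real.exp (2 * x) + 2 * k ^ 2 * Real.exp (-2 * x) := by
    refine (ae_restrict_iff' measurableSet_Ioc).2 ?_
    filter_upwards [hd, Measure.ae_ne volume a] with x hx hne hmem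
    simpa using energy_density_of_eqOn isOpen_Ioo hmid
      ⟨hmem.1, lt_of_le_of_ne hmem.2 hne⟩ hx
  have eright : (fun x => v x ^ 2 + v' x ^ 2) =ᵐ[volume.restrict (Set.Ioi a)]
      fun x => 2 * m ^ 2 * Real.exp (-2 * x) := by
    refine (ae_restrict_iff' measurableSet_Ioi).2 ?_
    filter_upwards [hd] with x hx hmem
    simpa using energy_density_of_eqOn isOpen_Ioi hright hmem hx
  have ileft : IntegrableOn (fun x => v x ^ 2 + v' x ^ 2) (Set.Iic (-a)) :=
    ((integrableOn_exp_mul_Iic two_pos (-a)).const_mul (2 * m ^ 2)).congr eleft.symm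
  have imid : IntegrableOn (fun x => v x ^ 2 + v' x ^ 2) (Set.Ioc (-a) a) := by
    refine Integrable.congr ?_ emid.symm
    exact Continuous.integrableOn_Ioc (by fun_prop)
  have iright : IntegrableOn (fun x => v x ^ 2 + v' x ^ 2) (Set.Ioi a) :=
    ((integrableOn_exp_mul_Ioi (by norm_num : (-2 : ℝ) < 0) a).const_mul (2 * m ^ 2)).congr
      eright.symm
  have hmid_int : ∫ x in Set.Ioc (-a) a,
      (2 * k ^ 2 * Real.exp (2 * x) + 2 * k ^ 2 * Real.exp (-2 * x)) =
      2 * k ^ 2 * (Real.exp (2 * a) - Real.exp (-2 * a)) := by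
    rw [← intervalIntegral.integral_of_le (by linarith)]
    have hderiv : ∀ x ∈ Set.uIcc (-a) a, HasDerivAt
        (fun x => k ^ 2 * (Real.exp (2 * x) - Real.exp (-2 * x)))
        (2 * k ^ 2 * Real.exp (2 * x) + 2 * k ^ 2 * Real.exp (-2 * x)) x := by
      intro x _
      convert! ((((hasDerivAt_id x).const_mul (2 : ℝ)).exp).sub
        (((hasDerivAt_id x).const_mul (-2 : ℝ)).exp)).const_mul (k ^ 2) using 1
      simp only [id]
      ring
    rw [intervalIntegral.integral_eq_sub_of_hasDerivAt hderiv
      (Continuous.intervalIntegrable (by fun_prop) _ _),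
      show 2 * -a = -2 * a by ring, show -2 * -a = 2 * a by ring]
    ring
  have iIoi : IntegrableOn (fun x => v x ^ 2 + v' x ^ 2) (Set.Ioi (-a)) := by
    rw [← Set.Ioc_union_Ioi_eq_Ioi (by linarith : -a ≤ a)]
    exact imid.union iright
  rw [← intervalIntegral.integral_Iic_add_Ioi ileft iIoi,
    ← intervalIntegral.integral_interval_add_Ioi iIoi iright,
    intervalIntegral.integral_of_le (by linarith : -a ≤ a),
    integral_congr_ae eleft, integral_congr_ae emid, integral_congr_ae eright, hmid_int,
    integral_const_mul, integral_const_mul, integral_exp_mul_Iic two_pos,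
    integral_exp_mul_Ioi (by norm_num : (-2 : ℝ) < 0), hm, hk]
  have h₁ : Real.exp (2 * a) = Real.exp a ^ 2 := by rw [← Real.exp_nat_mul]; norm_num
  have h₂ : Real.exp (-2 * a) = Real.exp (-a) ^ 2 := by
    rw [← Real.exp_nat_mul]; congr 1; push_cast; ring
  rw [show 2 * -a = -2 * a by ring, h₁, h₂, Real.exp_neg]
  field_simp
  ring

/-- Peakon–antipeakon: for every `t < t*` the energy
`∫_ℝ (u(t, y)² + u_x(t, y)²) dy` equals `4D²`, where `u_x(t, ·)` is the
almost-everywhere derivative of `u(t, ·)`. -/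
theorem peakon_antipeakon_energy (D tstar : ℝ) (hD : 0 < D)
    (p q : ℝ → ℝ) (u ux : ℝ → ℝ → ℝ)
    (hp : ∀ t < tstar, p t =
      D * (1 + Real.exp (2 * D * (t - tstar))) / (1 - Real.exp (2 * D * (t - tstar))))
    (hq : ∀ t < tstar, q t =
      Real.log (2 * Real.exp (D * (t - tstar)) / (1 + Real.exp (2 * D * (t - tstar)))))
    (hu : ∀ t < tstar, ∀ x : ℝ,
      u t x = p t * (Real.exp (-|x - q t|) - Real.exp (-|x + q t|)))
    (hux : ∀ t < tstar, ∀ᵐ x : ℝ, HasDerivAt (u t) (ux t x) x) :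
    ∀ t < tstar, (∫ y : ℝ, (u t y ^ 2 + ux t y ^ 2)) = 4 * D ^ 2 := by
  intro t ht
  set s := Real.exp (D * (t - tstar)) with hs
  have hs₀ : 0 < s := Real.exp_pos _
  have hs₁ : s < 1 := Real.exp_lt_one_iff.2 (mul_neg_of_pos_of_neg hD (by linarith))
  have hs₂ : Real.exp (2 * D * (t - tstar)) = s ^ 2 := by
    rw [hs, ← Real.exp_nat_mul]; congr 1; push_cast; ring
  have hpt := hp t ht
  have hqt := hq t ht
  rw [hs₂] at hpt hqt
  have hq₀ : q t < 0 := by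
    rw [hqt]
    refine Real.log_neg (by positivity) ?_
    rw [div_lt_one (by positivity)]
    nlinarith [sq_pos_of_pos (sub_pos.2 hs₁)]
  have hexp : Real.exp (q t) = 2 * s / (1 + s ^ 2) := by
    rw [hqt, Real.exp_log (by positivity)]
  rw [integral_energy_peakon_sub (a := -q t) (c := p t) (by linarith)
    (fun x => by rw [hu t ht x, sub_neg_eq_add, ← sub_eq_add_neg]) (hux t ht),
    neg_neg, hexp, hpt]
  have h : 1 - s ^ 2 ≠ 0 := by nlinarith
  field_simp
  ring
end

section
/- With the peakon–antipeakon data, for every t < t* and every x ∈ ℝ the cumulative energy F(t, x) = ∫_{−∞}^x (u(t, y)² + u_x(t, y)²) dy is given explicitly by: F(t, x) = D²(1 − e^{2q(t)}) e^{2(x−q(t))} if x ≤ q(t); F(t, x) = 2D² + 2p(t)² e^{2q(t)} sinh(2x) if q(t) ≤ x ≤ −q(t); and F(t, x) = 4D² − D²(1 − e^{2q(t)}) e^{−2(x+q(t))} if −q(t) ≤ x. -/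
open MeasureTheory Filter

/-- Extending a lower-unbounded set integral past `a` by the fundamental theorem of calculus, when
the integrand agrees a.e. on `(a, b)` with a continuous derivative. -/
theorem integral_Iic_extend {f g G : ℝ → ℝ} {a b : ℝ} (hab : a ≤ b)
    (hf : IntegrableOn f (Set.Iic a)) (hG : ∀ y, HasDerivAt G (g y) y) (hg : Continuous g)
    (hfg : ∀ᵐ y : ℝ, y ∈ Set.Ioo a b → f y = g y) :
    IntegrableOn f (Set.Iic b) ∧
      ∫ y in Set.Iic b, f y = (∫ y in Set.Iic a, f y) + (G b - G a) := by
  have hfg' : ∀ᵐ y : ℝ, y ∈ Set.Ioc a b → f y = g y := by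
    filter_upwards [hfg, Measure.ae_ne volume b] with y hy hne hmem
    exact hy ⟨hmem.1, lt_of_le_of_ne hmem.2 hne⟩
  have hint : IntegrableOn f (Set.Ioc a b) :=
    (hg.integrableOn_Ioc).congr_fun_ae
      (((ae_restrict_iff' measurableSet_Ioc).2 hfg').mono fun y hy => hy.symm)
  have hb : IntegrableOn f (Set.Iic b) := by
    rw [← Set.Iic_union_Ioc_eq_Iic hab]
    exact hf.union hint
  refine ⟨hb, ?_⟩
  have h₁ := intervalIntegral.integral_Iic_sub_Iic hf hb
  have h₂ : ∫ y in a..b, f y = ∫ y in a..b, g y := by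
    rw [intervalIntegral.integral_of_le hab, intervalIntegral.integral_of_le hab]
    exact setIntegral_congr_ae measurableSet_Ioc hfg'
  have h₃ := intervalIntegral.integral_eq_sub_of_hasDerivAt (fun y _ => hG y)
    (hg.intervalIntegrable a b)
  linarith

/-- On an open set where `v` coincides with a differentiable `w`, an a.e. derivative of `v` is
a.e. the derivative of `w`. -/
theorem ae_sq_add_sq_eq {v vx w w' : ℝ → ℝ} {s : Set ℝ} (hs : IsOpen s)
    (hv : ∀ᵐ y : ℝ, HasDerivAt v (vx y) y) (hw : ∀ y, HasDerivAt w (w' y) y)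
    (hvw : ∀ y ∈ s, v y = w y) :
    ∀ᵐ y : ℝ, y ∈ s → v y ^ 2 + vx y ^ 2 = w y ^ 2 + w' y ^ 2 := by
  filter_upwards [hv] with y hy hmem
  have h : HasDerivAt v (w' y) y :=
    (hw y).congr_of_eventuallyEq (eventually_of_mem (hs.mem_nhds hmem) hvw)
  rw [hvw y hmem, hy.unique h]

/-- The cumulative energy of a symmetric peakon–antipeakon pair with amplitude `p` and peak
positions `±q`, where `q ≤ 0`. -/
theorem integral_Iic_peakon_antipeakon {p q : ℝ} (hq : q ≤ 0) {v vx : ℝ → ℝ}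
    (hv : ∀ x, v x = p * (Real.exp (-|x - q|) - Real.exp (-|x + q|)))
    (hvx : ∀ᵐ x : ℝ, HasDerivAt v (vx x) x) (x : ℝ) :
    (x ≤ q → ∫ y in Set.Iic x, (v y ^ 2 + vx y ^ 2) =
      (p * (Real.exp (-q) - Real.exp q)) ^ 2 * Real.exp (2 * x)) ∧
    (q ≤ x → x ≤ -q → ∫ y in Set.Iic x, (v y ^ 2 + vx y ^ 2) =
      (p * (Real.exp (-q) - Real.exp q)) ^ 2 * Real.exp (2 * q) +
        2 * (p * Real.exp q) ^ 2 * (Real.sinh (2 * x) - Real.sinh (2 * q))) ∧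
    (-q ≤ x → ∫ y in Set.Iic x, (v y ^ 2 + vx y ^ 2) =
      (p * (Real.exp (-q) - Real.exp q)) ^ 2 * (2 * Real.exp (2 * q) - Real.exp (-2 * x)) +
        2 * (p * Real.exp q) ^ 2 * (Real.sinh (-2 * q) - Real.sinh (2 * q))) := by
  set c := p * (Real.exp (-q) - Real.exp q) with hc
  set d := p * Real.exp q with hd
  have hleft := ae_sq_add_sq_eq (w := fun y => c * Real.exp y) (w' := fun y => c * Real.exp y)
    (isOpen_Iio (a := q)) hvx (fun y => (Real.hasDerivAt_exp y).const_mul c) (by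
      intro y hy
      have hy : y < q := hy
      rw [hv, abs_of_nonpos (by linarith), abs_of_nonpos (by linarith),
        show -(-(y - q)) = -q + y by ring, show -(-(y + q)) = q + y by ring,
        Real.exp_add, Real.exp_add, hc]
      ring)
  have hmid := ae_sq_add_sq_eq (w := fun y => -2 * d * Real.sinh y)
    (w' := fun y => -2 * d * Real.cosh y)
    (isOpen_Ioo (a := q) (b := -q)) hvx (fun y => (Real.hasDerivAt_sinh y).const_mul (-2 * d)) (by
      rintro y ⟨hy, hy'⟩
      rw [hv, abs_of_nonneg (by linarith), abs_of_nonpos (by linarith),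
        show -(y - q) = q + -y by ring, show -(-(y + q)) = q + y by ring,
        Real.exp_add, Real.exp_add, hd, Real.sinh_eq]
      ring)
  have hright := ae_sq_add_sq_eq (w := fun y => -c * Real.exp (-y))
    (w' := fun y => -c * (Real.exp (-y) * -1))
    (isOpen_Ioi (a := -q)) hvx (fun y => ((hasDerivAt_neg y).exp).const_mul (-c)) (by
      intro y hy
      have hy : -q < y := hy
      rw [hv, abs_of_nonneg (by linarith), abs_of_nonneg (by linarith),
        show -(y - q) = q + -y by ring, show -(y + q) = -q + -y by ring,
        Real.exp_add, Real.exp_add, hc]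
      ring)
  have hL : ∀ x ≤ q, IntegrableOn (fun y => v y ^ 2 + vx y ^ 2) (Set.Iic x) ∧
      ∫ y in Set.Iic x, (v y ^ 2 + vx y ^ 2) = c ^ 2 * Real.exp (2 * x) := by
    intro x hx
    have hae : ∀ᵐ y : ℝ, y ∈ Set.Iic x →
        v y ^ 2 + vx y ^ 2 = 2 * c ^ 2 * Real.exp (2 * y) := by
      filter_upwards [hleft, Measure.ae_ne volume q] with y hy hne hmem
      rw [hy (lt_of_le_of_ne (le_trans hmem hx) hne), two_mul y, Real.exp_add]
      ring
    constructor
    · exact ((integrableOn_exp_mul_Iic (by norm_num : (0 : ℝ) < 2) x).const_mul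
        (2 * c ^ 2)).congr
        (((ae_restrict_iff' measurableSet_Iic).2 hae).mono fun y hy => hy.symm)
    · rw [setIntegral_congr_ae measurableSet_Iic hae, integral_const_mul,
        integral_exp_mul_Iic (by norm_num : (0 : ℝ) < 2)]
      ring
  have hM : ∀ x, q ≤ x → x ≤ -q → IntegrableOn (fun y => v y ^ 2 + vx y ^ 2) (Set.Iic x) ∧
      ∫ y in Set.Iic x, (v y ^ 2 + vx y ^ 2) = c ^ 2 * Real.exp (2 * q) +
        2 * d ^ 2 * (Real.sinh (2 * x) - Real.sinh (2 * q)) := by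
    intro x hx hx'
    have h := integral_Iic_extend (G := fun y => 2 * d ^ 2 * Real.sinh (2 * y))
      (g := fun y => 2 * d ^ 2 * (Real.cosh (2 * y) * (2 * 1))) hx (hL q le_rfl).1
      (fun y => (((hasDerivAt_id y).const_mul 2).sinh).const_mul _) (by fun_prop) (by
        filter_upwards [hmid] with y hy hmem
        rw [hy ⟨hmem.1, hmem.2.trans_le hx'⟩, Real.cosh_two_mul]
        ring)
    refine ⟨h.1, ?_⟩
    rw [h.2, (hL q le_rfl).2]
    ring
  refine ⟨fun hx => (hL x hx).2, fun hx hx' => (hM x hx hx').2, fun hx => ?_⟩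
  have hq' := hM (-q) (by linarith) le_rfl
  have h := integral_Iic_extend (G := fun y => -c ^ 2 * Real.exp (-2 * y))
    (g := fun y => -c ^ 2 * (Real.exp (-2 * y) * (-2 * 1))) hx hq'.1
    (fun y => (((hasDerivAt_id y).const_mul (-2)).exp).const_mul _) (by fun_prop) (by
      filter_upwards [hright] with y hy hmem
      rw [hy hmem.1, show -2 * y = -y + -y by ring, Real.exp_add]
      ring)
  rw [h.2, hq'.2, show -2 * -q = 2 * q by ring, show 2 * -q = -2 * q by ring]
  ring

/-- Peakon–antipeakon: explicit formula for the cumulative energy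
`F(t, x) = ∫_{−∞}^x (u(t, y)² + u_x(t, y)²) dy` for `t < t*`, in each of the three
regions `x ≤ q(t)`, `q(t) ≤ x ≤ −q(t)`, and `−q(t) ≤ x`. -/
theorem peakon_antipeakon_cumulative_energy (D tstar : ℝ) (hD : 0 < D)
    (p q : ℝ → ℝ) (u ux : ℝ → ℝ → ℝ) (F : ℝ → ℝ → ℝ)
    (hp : ∀ t < tstar, p t =
      D * (1 + Real.exp (2 * D * (t - tstar))) / (1 - Real.exp (2 * D * (t - tstar))))
    (hq : ∀ t < tstar, q t =
      Real.log (2 * Real.exp (D * (t - tstar)) / (1 + Real.exp (2 * D * (t - tstar)))))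
    (hu : ∀ t < tstar, ∀ x : ℝ,
      u t x = p t * (Real.exp (-|x - q t|) - Real.exp (-|x + q t|)))
    (hux : ∀ t < tstar, ∀ᵐ x : ℝ, HasDerivAt (u t) (ux t x) x)
    (hF : ∀ t < tstar, ∀ x : ℝ,
      F t x = ∫ y in Set.Iic x, (u t y ^ 2 + ux t y ^ 2)) :
    ∀ t < tstar, ∀ x : ℝ,
      (x ≤ q t →
        F t x = D ^ 2 * (1 - Real.exp (2 * q t)) * Real.exp (2 * (x - q t))) ∧
      (q t ≤ x → x ≤ -q t →
        F t x = 2 * D ^ 2 + 2 * p t ^ 2 * Real.exp (2 * q t) * Real.sinh (2 * x)) ∧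
      (-q t ≤ x →
        F t x = 4 * D ^ 2 -
          D ^ 2 * (1 - Real.exp (2 * q t)) * Real.exp (-2 * (x + q t))) := by
  intro t ht x
  have hneg : D * (t - tstar) < 0 := mul_neg_of_pos_of_neg hD (by linarith)
  have hp := hp t ht
  have hq := hq t ht
  rw [show 2 * D * (t - tstar) = D * (t - tstar) + D * (t - tstar) by ring, Real.exp_add] at hp hq
  set E := Real.exp (D * (t - tstar))
  have hE₀ : 0 < E := Real.exp_pos _
  have hE₁ : E < 1 := Real.exp_lt_one_iff.2 hneg
  have hEE : 1 - E ^ 2 ≠ 0 := by nlinarith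
  have hexp : Real.exp (q t) = 2 * E / (1 + E * E) := by
    rw [hq, Real.exp_log (by positivity)]
  have hq₀ : q t ≤ 0 := by
    rw [← Real.exp_le_one_iff, hexp, div_le_one (by positivity)]
    nlinarith [sq_nonneg (1 - E)]
  have hpD : p t ^ 2 * (1 - Real.exp (q t) ^ 2) = D ^ 2 := by
    rw [hp, hexp, ← sq E]
    field_simp
    ring
  obtain ⟨h₁, h₂, h₃⟩ := integral_Iic_peakon_antipeakon hq₀ (hu t ht) (hux t ht) x
  have htwo : ∀ y : ℝ, Real.exp (2 * y) = Real.exp y ^ 2 := fun y => by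
    rw [two_mul, Real.exp_add, sq]
  have hmtwo : ∀ y : ℝ, Real.exp (-2 * y) = (Real.exp y ^ 2)⁻¹ := fun y => by
    rw [← htwo, ← Real.exp_neg, neg_mul]
  rw [hF t ht x]
  refine ⟨fun hx => ?_, fun hx hx' => ?_, fun hx => ?_⟩
  · rw [h₁ hx, ← hpD]
    simp only [htwo, Real.exp_neg, Real.exp_sub]
    field_simp
  · rw [h₂ hx hx', ← hpD, Real.sinh_eq (2 * q t)]
    simp only [htwo, Real.exp_neg]
    field_simp
    ring
  · rw [h₃ hx, ← hpD, Real.sinh_eq (2 * q t), Real.sinh_eq (-2 * q t)]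
    simp only [htwo, hmtwo, Real.exp_neg, Real.exp_add]
    field_simp
    ring
end

section
/- With the peakon–antipeakon data, let F(t, x) = ∫_{−∞}^x (u(t, y)² + u_x(t, y)²) dy for t < t*. Then for every x < 0, F(t, x) → 0 as t → t*⁻, and for every x > 0, F(t, x) → 4D² as t → t*⁻; in particular the cumulative energy develops a jump of height 4D² across the half line {t*} × [0, ∞). -/
open MeasureTheory Filter

/-- If `f` agrees on an open set `s` with `g`, then almost everywhere on `s` the energy density of
`f` agrees with that of `g`. -/
theorem ae_restrict_energy_density_eq {f f' g g' : ℝ → ℝ} {s : Set ℝ} (hs : IsOpen s)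
    (hf : ∀ᵐ x : ℝ, HasDerivAt f (f' x) x) (hfg : Set.EqOn f g s)
    (hg : ∀ x ∈ s, HasDerivAt g (g' x) x) :
    (fun y => f y ^ 2 + f' y ^ 2) =ᵐ[volume.restrict s] fun y => g y ^ 2 + g' y ^ 2 := by
  filter_upwards [ae_restrict_of_ae hf, ae_restrict_mem hs.measurableSet] with y hy hys
  have hd : HasDerivAt g (f' y) y :=
    hy.congr_of_eventuallyEq (hfg.symm.eventuallyEq_of_mem (hs.mem_nhds hys))
  rw [hfg hys, hd.unique (hg y hys)]

theorem hasDerivAt_mul_exp_two_mul (c x : ℝ) :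
    HasDerivAt (fun y => c * Real.exp (2 * y)) (2 * c * Real.exp (2 * x)) x := by
  have h := (((hasDerivAt_id' x).const_mul 2).exp).const_mul c
  exact h.congr_deriv (by ring)

theorem hasDerivAt_mul_exp_neg_two_mul (c x : ℝ) :
    HasDerivAt (fun y => c * Real.exp (-2 * y)) (-2 * c * Real.exp (-2 * x)) x := by
  have h := (((hasDerivAt_id' x).const_mul (-2)).exp).const_mul c
  exact h.congr_deriv (by ring)

theorem tendsto_mul_exp_two_mul_atBot (c : ℝ) :
    Tendsto (fun y => c * Real.exp (2 * y)) atBot (nhds 0) := by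
  have h := (Real.tendsto_exp_atBot.comp
    (tendsto_id.const_mul_atBot (two_pos : (0 : ℝ) < 2))).const_mul c
  simpa [Function.comp_def] using h

theorem integrableOn_mul_exp_two_mul_Iic (c x : ℝ) :
    IntegrableOn (fun y => 2 * c * Real.exp (2 * y)) (Set.Iic x) :=
  (integrableOn_exp_mul_Iic two_pos x).const_mul (2 * c)

theorem integral_mul_exp_two_mul_Iic (c x : ℝ) :
    ∫ y in Set.Iic x, 2 * c * Real.exp (2 * y) = c * Real.exp (2 * x) := by
  simpa using integral_Iic_of_hasDerivAt_of_tendsto'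
    (fun y _ => hasDerivAt_mul_exp_two_mul c y) (integrableOn_mul_exp_two_mul_Iic c x)
    (tendsto_mul_exp_two_mul_atBot c)

section Profile

variable {P a : ℝ} {f f' : ℝ → ℝ}

theorem energy_density_left (ha : 0 < a)
    (hf : ∀ x, f x = P * (Real.exp (-|x + a|) - Real.exp (-|x - a|)))
    (hf' : ∀ᵐ x : ℝ, HasDerivAt f (f' x) x) :
    (fun y => f y ^ 2 + f' y ^ 2) =ᵐ[volume.restrict (Set.Iic (-a))]
      fun y => 2 * (P * (Real.exp a - Real.exp (-a))) ^ 2 * Real.exp (2 * y) := by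
  rw [← restrict_Iio_eq_restrict_Iic]
  have h := ae_restrict_energy_density_eq (isOpen_Iio (a := -a)) hf'
    (g := fun y => P * (Real.exp a - Real.exp (-a)) * Real.exp y)
    (g' := fun y => P * (Real.exp a - Real.exp (-a)) * Real.exp y)
    (fun y hy => ?_) (fun y _ => (Real.hasDerivAt_exp y).const_mul _)
  · refine h.trans (.of_forall fun y => ?_)
    simp only [two_mul y, Real.exp_add]
    ring
  · have hy : y < -a := hy
    rw [hf, abs_of_neg (by linarith), abs_of_neg (by linarith),
      show -(-(y + a)) = a + y by ring, show -(-(y - a)) = -a + y by ring, Real.exp_add,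
      Real.exp_add]
    ring

theorem energy_density_middle
    (hf : ∀ x, f x = P * (Real.exp (-|x + a|) - Real.exp (-|x - a|)))
    (hf' : ∀ᵐ x : ℝ, HasDerivAt f (f' x) x) :
    (fun y => f y ^ 2 + f' y ^ 2) =ᵐ[volume.restrict (Set.Ioc (-a) a)]
      fun y => 2 * (P * Real.exp (-a)) ^ 2 * Real.exp (2 * y) -
        -2 * (P * Real.exp (-a)) ^ 2 * Real.exp (-2 * y) := by
  rw [← restrict_Ioo_eq_restrict_Ioc]
  have h := ae_restrict_energy_density_eq (isOpen_Ioo (a := -a) (b := a)) hf'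
    (g := fun y => P * Real.exp (-a) * (Real.exp (-y) - Real.exp y))
    (g' := fun y => P * Real.exp (-a) * (Real.exp (-y) * -1 - Real.exp y))
    (fun y hy => ?_)
    (fun y _ => (((hasDerivAt_neg y).exp).sub (Real.hasDerivAt_exp y)).const_mul _)
  · refine h.trans (.of_forall fun y => ?_)
    simp only [show -2 * y = -y + -y by ring, two_mul y, Real.exp_add]
    ring
  · rw [hf, abs_of_pos (by linarith [hy.1]), abs_of_neg (by linarith [hy.2]),
      show -(y + a) = -a + -y by ring, show -(-(y - a)) = -a + y by ring, Real.exp_add,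
      Real.exp_add]
    ring

theorem energy_density_right (ha : 0 < a)
    (hf : ∀ x, f x = P * (Real.exp (-|x + a|) - Real.exp (-|x - a|)))
    (hf' : ∀ᵐ x : ℝ, HasDerivAt f (f' x) x) :
    (fun y => f y ^ 2 + f' y ^ 2) =ᵐ[volume.restrict (Set.Ioi a)]
      fun y => -2 * -(P * (Real.exp a - Real.exp (-a))) ^ 2 * Real.exp (-2 * y) := by
  have h := ae_restrict_energy_density_eq (isOpen_Ioi (a := a)) hf'
    (g := fun y => P * (Real.exp (-a) - Real.exp a) * Real.exp (-y))
    (g' := fun y => P * (Real.exp (-a) - Real.exp a) * (Real.exp (-y) * -1))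
    (fun y hy => ?_) (fun y _ => ((hasDerivAt_neg y).exp).const_mul _)
  · refine h.trans (.of_forall fun y => ?_)
    simp only [show -2 * y = -y + -y by ring, Real.exp_add]
    ring
  · have hy : a < y := hy
    rw [hf, abs_of_pos (by linarith), abs_of_pos (by linarith),
      show -(y + a) = -a + -y by ring, show -(y - a) = a + -y by ring, Real.exp_add,
      Real.exp_add]
    ring

/-- Cumulative energy of the peakon–antipeakon profile to the left of both peaks. -/
theorem integral_energy_left (ha : 0 < a)
    (hf : ∀ x, f x = P * (Real.exp (-|x + a|) - Real.exp (-|x - a|)))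
    (hf' : ∀ᵐ x : ℝ, HasDerivAt f (f' x) x) {x : ℝ} (hx : x ≤ -a) :
    ∫ y in Set.Iic x, (f y ^ 2 + f' y ^ 2) =
      (P * (Real.exp a - Real.exp (-a))) ^ 2 * Real.exp (2 * x) := by
  rw [← integral_mul_exp_two_mul_Iic]
  exact integral_congr_ae
    (ae_restrict_of_ae_restrict_of_subset (Set.Iic_subset_Iic.2 hx) (energy_density_left ha hf hf'))

/-- Cumulative energy of the peakon–antipeakon profile to the right of both peaks. -/
theorem integral_energy_right (ha : 0 < a)
    (hf : ∀ x, f x = P * (Real.exp (-|x + a|) - Real.exp (-|x - a|)))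
    (hf' : ∀ᵐ x : ℝ, HasDerivAt f (f' x) x) {x : ℝ} (hx : a ≤ x) :
    ∫ y in Set.Iic x, (f y ^ 2 + f' y ^ 2) =
      (P * (Real.exp a - Real.exp (-a))) ^ 2 * (2 * Real.exp (-2 * a) - Real.exp (-2 * x)) +
        2 * (P * Real.exp (-a)) ^ 2 * (Real.exp (2 * a) - Real.exp (-2 * a)) := by
  have hl := energy_density_left ha hf hf'
  have hm := energy_density_middle hf hf'
  have hr := ae_restrict_of_ae_restrict_of_subset
    (Set.Ioc_subset_Ioi_self : Set.Ioc a x ⊆ Set.Ioi a) (energy_density_right ha hf hf')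
  have cm : Continuous fun y => 2 * (P * Real.exp (-a)) ^ 2 * Real.exp (2 * y) -
      -2 * (P * Real.exp (-a)) ^ 2 * Real.exp (-2 * y) := by fun_prop
  have cr : Continuous fun y =>
      -2 * -(P * (Real.exp a - Real.exp (-a))) ^ 2 * Real.exp (-2 * y) := by fun_prop
  have il : IntegrableOn (fun y => f y ^ 2 + f' y ^ 2) (Set.Iic (-a)) :=
    (integrableOn_mul_exp_two_mul_Iic _ _).congr hl.symm
  have im : IntegrableOn (fun y => f y ^ 2 + f' y ^ 2) (Set.Ioc (-a) a) :=
    cm.integrableOn_Ioc.congr hm.symm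
  have ir : IntegrableOn (fun y => f y ^ 2 + f' y ^ 2) (Set.Ioc a x) :=
    cr.integrableOn_Ioc.congr (EventuallyEq.symm hr)
  have hma : -a ≤ a := by linarith
  have ilm : IntegrableOn (fun y => f y ^ 2 + f' y ^ 2) (Set.Iic a) := by
    rw [← Set.Iic_union_Ioc_eq_Iic hma]
    exact il.union im
  rw [← Set.Iic_union_Ioc_eq_Iic hx,
    setIntegral_union (Set.Iic_disjoint_Ioc le_rfl) measurableSet_Ioc ilm ir,
    ← Set.Iic_union_Ioc_eq_Iic hma,
    setIntegral_union (Set.Iic_disjoint_Ioc le_rfl) measurableSet_Ioc il im,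
    integral_energy_left ha hf hf' le_rfl, integral_congr_ae hm, integral_congr_ae hr,
    ← intervalIntegral.integral_of_le hma, ← intervalIntegral.integral_of_le hx,
    intervalIntegral.integral_eq_sub_of_hasDerivAt
      (fun y _ => (hasDerivAt_mul_exp_two_mul _ y).sub (hasDerivAt_mul_exp_neg_two_mul _ y))
      (cm.intervalIntegrable _ _),
    intervalIntegral.integral_eq_sub_of_hasDerivAt
      (fun y _ => hasDerivAt_mul_exp_neg_two_mul _ y) (cr.intervalIntegrable _ _)]
  simp only [Pi.sub_apply, mul_neg, neg_mul, neg_neg]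
  ring

end Profile

/-- Peakon–antipeakon: as `t → t*⁻`, the cumulative energy
`F(t, x) = ∫_{−∞}^x (u(t, y)² + u_x(t, y)²) dy` tends to `0` for every `x < 0`
and to `4D²` for every `x > 0`. -/
theorem peakon_antipeakon_energy_jump (D tstar : ℝ) (hD : 0 < D)
    (p q : ℝ → ℝ) (u ux : ℝ → ℝ → ℝ) (F : ℝ → ℝ → ℝ)
    (hp : ∀ t < tstar, p t =
      D * (1 + Real.exp (2 * D * (t - tstar))) / (1 - Real.exp (2 * D * (t - tstar))))
    (hq : ∀ t < tstar, q t =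
      Real.log (2 * Real.exp (D * (t - tstar)) / (1 + Real.exp (2 * D * (t - tstar)))))
    (hu : ∀ t < tstar, ∀ x : ℝ,
      u t x = p t * (Real.exp (-|x - q t|) - Real.exp (-|x + q t|)))
    (hux : ∀ t < tstar, ∀ᵐ x : ℝ, HasDerivAt (u t) (ux t x) x)
    (hF : ∀ t < tstar, ∀ x : ℝ,
      F t x = ∫ y in Set.Iic x, (u t y ^ 2 + ux t y ^ 2)) :
    (∀ x : ℝ, x < 0 →
      Tendsto (fun t => F t x) (nhdsWithin tstar (Set.Iio tstar)) (nhds 0)) ∧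
    (∀ x : ℝ, 0 < x →
      Tendsto (fun t => F t x) (nhdsWithin tstar (Set.Iio tstar))
        (nhds (4 * D ^ 2))) := by
  set s : ℝ → ℝ := fun t => Real.exp (D * (t - tstar)) with hs
  set E : ℝ → ℝ := fun t => (1 + s t ^ 2) / (2 * s t) with hE
  have s_pos : ∀ t, 0 < s t := fun t => Real.exp_pos _
  have s_sq : ∀ t, Real.exp (2 * D * (t - tstar)) = s t ^ 2 := fun t => by
    rw [hs, ← Real.exp_nat_mul]
    push_cast
    ring_nf
  have s_lt : ∀ t < tstar, s t < 1 := fun t ht =>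
    Real.exp_lt_one_iff.2 (mul_neg_of_pos_of_neg hD (by linarith))
  have E_pos : ∀ t, 0 < E t := fun t => by
    have := s_pos t
    positivity
  have exp_neg_q : ∀ t < tstar, Real.exp (-q t) = E t := fun t ht => by
    have := s_pos t
    rw [hq t ht, s_sq, ← Real.log_inv, Real.exp_log (by positivity), inv_div]
  have exp_q : ∀ t < tstar, Real.exp (q t) = (E t)⁻¹ := fun t ht => by
    rw [← exp_neg_q t ht, Real.exp_neg, inv_inv]
  have q_neg : ∀ t < tstar, 0 < -q t := fun t ht => by
    rw [← Real.one_lt_exp_iff, exp_neg_q t ht, hE, one_lt_div (by linarith [s_pos t])]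
    nlinarith [mul_pos (sub_pos.2 (s_lt t ht)) (sub_pos.2 (s_lt t ht))]
  have p_sq : ∀ t < tstar, p t ^ 2 * (E t ^ 2 - 1) = D ^ 2 * E t ^ 2 := fun t ht => by
    have h0 := (s_pos t).ne'
    have h1 : 1 - s t ^ 2 ≠ 0 := by nlinarith [s_pos t, s_lt t ht]
    rw [hp t ht, s_sq]
    simp only [hE]
    field_simp
    ring
  have amplitude : ∀ t < tstar,
      (p t * (Real.exp (-q t) - Real.exp (-(-q t)))) ^ 2 = D ^ 2 * (E t ^ 2 - 1) := fun t ht => by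
    have h0 := (E_pos t).ne'
    rw [neg_neg, exp_neg_q t ht, exp_q t ht]
    field_simp
    linear_combination (E t ^ 2 - 1) * p_sq t ht
  have profile : ∀ t < tstar, ∀ x,
      u t x = p t * (Real.exp (-|x + -q t|) - Real.exp (-|x - -q t|)) := fun t ht x => by
    rw [hu t ht x, sub_neg_eq_add, ← sub_eq_add_neg]
  have F_left : ∀ t < tstar, ∀ x ≤ -(-q t),
      F t x = D ^ 2 * (E t ^ 2 - 1) * Real.exp (2 * x) := fun t ht x hx => by
    rw [hF t ht, integral_energy_left (q_neg t ht) (profile t ht) (hux t ht) hx, amplitude t ht]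
  have F_right : ∀ t < tstar, ∀ x, -q t ≤ x →
      F t x = 4 * D ^ 2 - D ^ 2 * (E t ^ 2 - 1) * Real.exp (-2 * x) := fun t ht x hx => by
    have h0 := (E_pos t).ne'
    rw [hF t ht, integral_energy_right (q_neg t ht) (profile t ht) (hux t ht) hx, amplitude t ht,
      show -2 * -q t = q t + q t by ring, show 2 * -q t = -q t + -q t by ring, neg_neg,
      Real.exp_add, Real.exp_add, exp_q t ht, exp_neg_q t ht]
    field_simp
    linear_combination 2 * (E t ^ 2 + 1) * p_sq t ht
  have E_tendsto : Tendsto E (nhdsWithin tstar (Set.Iio tstar)) (nhds 1) := by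
    have hc : Continuous E := by
      have : ∀ t, 2 * s t ≠ 0 := fun t => by linarith [s_pos t]
      fun_prop (disch := assumption)
    have h1 : E tstar = 1 := by norm_num [hE, hs]
    exact h1 ▸ hc.continuousWithinAt.tendsto
  have lt_tstar : ∀ᶠ t in nhdsWithin tstar (Set.Iio tstar), t < tstar := self_mem_nhdsWithin
  have q_small : ∀ x, 0 < x → ∀ᶠ t in nhdsWithin tstar (Set.Iio tstar), -q t ≤ x := fun x hx => by
    filter_upwards [E_tendsto.eventually_lt_const (Real.one_lt_exp_iff.2 hx), lt_tstar] with t h ht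
    rw [← exp_neg_q t ht] at h
    exact (Real.exp_lt_exp.1 h).le
  have error_tendsto : ∀ c : ℝ, Tendsto (fun t => D ^ 2 * (E t ^ 2 - 1) * c)
      (nhdsWithin tstar (Set.Iio tstar)) (nhds 0) := fun c => by
    simpa using (((E_tendsto.pow 2).sub_const 1).const_mul (D ^ 2)).mul_const c
  refine ⟨fun x hx => ?_, fun x hx => ?_⟩
  · refine (error_tendsto (Real.exp (2 * x))).congr' ?_
    filter_upwards [q_small (-x) (neg_pos.2 hx), lt_tstar] with t h ht
    exact (F_left t ht x (by linarith)).symm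
  · have h := (error_tendsto (Real.exp (-2 * x))).const_sub (4 * D ^ 2)
    rw [sub_zero] at h
    refine h.congr' ?_
    filter_upwards [q_small x hx, lt_tstar] with t h ht
    exact (F_right t ht x h).symm
end

section
/- With the peakon–antipeakon data, let p(t, x) = (1/4)∫_ℝ e^{−|x−y|}(2u(t, y)² + u_x(t, y)²) dy for t < t*. Then for every x ∈ ℝ, p(t, x) → D² e^{−|x|} as t → t*⁻. -/
open MeasureTheory Filter
open Topology

lemma hasDerivAt_exp_neg_abs_sub_of_lt {c y : ℝ} (h : c < y) :
    HasDerivAt (fun x => Real.exp (-|x - c|)) (-Real.exp (-|y - c|)) y := by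
  have h1 := (((hasDerivAt_abs_pos (sub_pos.2 h)).comp y
    ((hasDerivAt_id y).sub_const c)).neg).exp
  simpa using h1

lemma hasDerivAt_exp_neg_abs_sub_of_gt {c y : ℝ} (h : y < c) :
    HasDerivAt (fun x => Real.exp (-|x - c|)) (Real.exp (-|y - c|)) y := by
  have h1 := (((hasDerivAt_abs_neg (sub_neg.2 h)).comp y
    ((hasDerivAt_id y).sub_const c)).neg).exp
  simpa using h1

lemma integrable_exp_neg_abs_sub_mul_exp_neg_two_mul_abs (x : ℝ) :
    Integrable fun y : ℝ => Real.exp (-|x - y|) * Real.exp (-2 * |y|) := by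
  have h : Integrable fun y : ℝ => Real.exp (-2 * |y|) := by
    rw [← integrableOn_univ, ← Set.Iic_union_Ioi (a := (0 : ℝ)), integrableOn_union]
    constructor
    · refine (integrableOn_exp_mul_Iic (a := 2) two_pos 0).congr_fun (fun y hy => ?_)
        measurableSet_Iic
      simp only [abs_of_nonpos (Set.mem_Iic.1 hy)]
      ring_nf
    · refine (integrableOn_exp_mul_Ioi (a := -2) (by norm_num) 0).congr_fun (fun y hy => ?_)
        measurableSet_Ioi
      simp only [abs_of_pos (Set.mem_Ioi.1 hy)]
  refine h.mono' (by fun_prop) (ae_of_all _ fun y => ?_)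
  rw [Real.norm_of_nonneg (by positivity)]
  exact mul_le_of_le_one_left (Real.exp_pos _).le (Real.exp_le_one_iff.2 (by simp))

/-- The energy integral of a peakon–antipeakon pair, split at the two peaks. -/
lemma integral_peakon_antipeakon (x P q : ℝ) (hq : q < 0) (v vx : ℝ → ℝ)
    (hv : ∀ y, v y = P * (Real.exp (-|y - q|) - Real.exp (-|y + q|)))
    (hvx : ∀ᵐ y : ℝ, HasDerivAt v (vx y) y) :
    ∫ y : ℝ, Real.exp (-|x - y|) * (2 * v y ^ 2 + vx y ^ 2) =
      P ^ 2 * Real.exp (2 * q) *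
        (∫ y in q..-q, Real.exp (-|x - y|) *
          (3 * Real.exp (2 * y) + 3 * Real.exp (-2 * y) - 2)) +
      3 * P ^ 2 * (Real.exp q - Real.exp (-q)) ^ 2 *
        ∫ y in (Set.Ioc q (-q))ᶜ, Real.exp (-|x - y|) * Real.exp (-2 * |y|) := by
  have hae : (fun y => Real.exp (-|x - y|) * (2 * v y ^ 2 + vx y ^ 2)) =ᵐ[volume] fun y =>
      (Set.Ioc q (-q)).indicator (fun y => P ^ 2 * Real.exp (2 * q) * (Real.exp (-|x - y|) *
          (3 * Real.exp (2 * y) + 3 * Real.exp (-2 * y) - 2))) y +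
      (Set.Ioc q (-q))ᶜ.indicator (fun y => 3 * P ^ 2 * (Real.exp q - Real.exp (-q)) ^ 2 *
        (Real.exp (-|x - y|) * Real.exp (-2 * |y|))) y := by
    filter_upwards [hvx, Measure.ae_ne volume q, Measure.ae_ne volume (-q)] with y hy hyq hyq'
    have hv' : v = fun y => P * (Real.exp (-|y - q|) - Real.exp (-|y - -q|)) := by
      funext y; rw [hv, sub_neg_eq_add]
    rcases lt_or_gt_of_ne hyq with h1 | h1
    · have h2 : y < -q := by linarith
      have hd : vx y = P * (Real.exp (-|y - q|) - Real.exp (-|y - -q|)) := by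
        rw [hv'] at hy
        exact hy.unique (((hasDerivAt_exp_neg_abs_sub_of_gt h1).sub
          (hasDerivAt_exp_neg_abs_sub_of_gt h2)).const_mul P)
      have hn : y ∉ Set.Ioc q (-q) := fun h => absurd h.1 h1.not_gt
      rw [Set.indicator_of_notMem hn, Set.indicator_of_mem (Set.mem_compl hn), hd, hv,
        sub_neg_eq_add, abs_of_neg (by linarith : y - q < 0), abs_of_neg (by linarith : y + q < 0),
        abs_of_neg (by linarith : y < 0)]
      have e1 : Real.exp (-(-(y - q))) = Real.exp y * Real.exp (-q) := by
        rw [← Real.exp_add]; ring_nf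
      have e2 : Real.exp (-(-(y + q))) = Real.exp y * Real.exp q := by
        rw [← Real.exp_add]; ring_nf
      have e3 : Real.exp (-2 * -y) = Real.exp y ^ 2 := by
        rw [← Real.exp_nat_mul]; push_cast; ring_nf
      rw [e1, e2, e3]
      ring
    rcases lt_or_gt_of_ne hyq' with h2 | h2
    · have hd : vx y = P * (-Real.exp (-|y - q|) - Real.exp (-|y - -q|)) := by
        rw [hv'] at hy
        exact hy.unique (((hasDerivAt_exp_neg_abs_sub_of_lt h1).sub
          (hasDerivAt_exp_neg_abs_sub_of_gt h2)).const_mul P)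
      have hm : y ∈ Set.Ioc q (-q) := ⟨h1, h2.le⟩
      rw [Set.indicator_of_mem hm, Set.indicator_of_notMem (by simpa using hm), hd, hv,
        sub_neg_eq_add, abs_of_pos (by linarith : 0 < y - q), abs_of_neg (by linarith : y + q < 0)]
      have e1 : Real.exp (-(y - q)) = (Real.exp y)⁻¹ * Real.exp q := by
        rw [← Real.exp_neg, ← Real.exp_add]; ring_nf
      have e2 : Real.exp (-(-(y + q))) = Real.exp y * Real.exp q := by
        rw [← Real.exp_add]; ring_nf
      have e3 : Real.exp (-2 * y) = (Real.exp y)⁻¹ ^ 2 := by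
        rw [← Real.exp_neg, ← Real.exp_nat_mul]; push_cast; ring_nf
      have e4 (z : ℝ) : Real.exp (2 * z) = Real.exp z ^ 2 := by
        rw [← Real.exp_nat_mul]; push_cast; ring_nf
      rw [e1, e2, e3, e4, e4]
      have := (Real.exp_pos y).ne'
      field_simp
      ring
    · have hd : vx y = P * (-Real.exp (-|y - q|) - -Real.exp (-|y - -q|)) := by
        rw [hv'] at hy
        exact hy.unique (((hasDerivAt_exp_neg_abs_sub_of_lt h1).sub
          (hasDerivAt_exp_neg_abs_sub_of_lt h2)).const_mul P)
      have hn : y ∉ Set.Ioc q (-q) := fun h => absurd h.2 h2.not_ge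
      rw [Set.indicator_of_notMem hn, Set.indicator_of_mem (Set.mem_compl hn), hd, hv,
        sub_neg_eq_add y, abs_of_pos (by linarith : 0 < y - q),
        abs_of_pos (by linarith : 0 < y + q), abs_of_pos (by linarith : 0 < y)]
      have e1 : Real.exp (-(y - q)) = Real.exp (-y) * Real.exp q := by
        rw [← Real.exp_add]; ring_nf
      have e2 : Real.exp (-(y + q)) = Real.exp (-y) * Real.exp (-q) := by
        rw [← Real.exp_add]; ring_nf
      have e3 : Real.exp (-2 * y) = Real.exp (-y) ^ 2 := by
        rw [← Real.exp_nat_mul]; push_cast; ring_nf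
      rw [e1, e2, e3]
      ring
  rw [integral_congr_ae hae, integral_add, integral_indicator measurableSet_Ioc,
    integral_indicator measurableSet_Ioc.compl, integral_const_mul, integral_const_mul,
    intervalIntegral.integral_of_le (by linarith)]
  · rw [integrable_indicator_iff measurableSet_Ioc]
    exact (Continuous.integrableOn_Icc (by fun_prop)).mono_set Set.Ioc_subset_Icc_self
  · exact ((integrable_exp_neg_abs_sub_mul_exp_neg_two_mul_abs x).const_mul _).indicator
      measurableSet_Ioc.compl

/-- Symmetric averages of a continuous function, normalised by `1 - e ^ (2q)`. -/
lemma tendsto_integral_symm_div_one_sub_exp {h : ℝ → ℝ} (hc : Continuous h) :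
    Tendsto (fun q => (∫ y in q..-q, h y) / (1 - Real.exp (2 * q))) (𝓝[<] 0) (𝓝 (h 0)) := by
  have hI (c : ℝ) : HasDerivAt (fun b => ∫ y in (0 : ℝ)..b, h y) (h c) c :=
    intervalIntegral.integral_hasDerivAt_right (hc.intervalIntegrable _ _)
      (hc.stronglyMeasurableAtFilter _ _) hc.continuousAt
  have h1 : HasDerivAt (fun q => ∫ y in q..-q, h y) (-2 * h 0) 0 := by
    have h2 := ((hI (-0)).comp 0 (hasDerivAt_neg (0 : ℝ))).sub (hI 0)
    refine (h2.congr_deriv (by rw [neg_zero]; ring)).congr_of_eventuallyEq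
      (Eventually.of_forall fun q => ?_)
    exact (intervalIntegral.integral_interval_sub_left (hc.intervalIntegrable _ _)
      (hc.intervalIntegrable _ _)).symm
  have h2 : HasDerivAt (fun q => 1 - Real.exp (2 * q)) (-2) 0 := by
    simpa using (((hasDerivAt_id (0 : ℝ)).const_mul 2).exp).const_sub 1
  have hlt : 𝓝[<] (0 : ℝ) ≤ 𝓝[≠] 0 := nhdsWithin_mono _ fun y hy => ne_of_lt hy
  have h3 := (h1.tendsto_slope.mono_left hlt).div (h2.tendsto_slope.mono_left hlt) (by norm_num)
  rw [mul_div_cancel_left₀ _ (by norm_num : (-2 : ℝ) ≠ 0)] at h3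
  refine h3.congr' ?_
  filter_upwards [self_mem_nhdsWithin] with q hq
  have : q ≠ 0 := ne_of_lt hq
  simp only [Pi.div_apply, slope_def_field, sub_zero, neg_zero, intervalIntegral.integral_same,
    mul_zero, Real.exp_zero, sub_self]
  rw [div_div_div_cancel_right₀ this]

/-- Peakon–antipeakon: with `P(t, x) = (1/4)∫_ℝ e^{−|x−y|}(2u(t, y)² + u_x(t, y)²) dy`
for `t < t*`, one has `P(t, x) → D² e^{−|x|}` as `t → t*⁻` for every `x ∈ ℝ`. -/
theorem peakon_antipeakon_p_limit (D tstar : ℝ) (hD : 0 < D)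
    (p q : ℝ → ℝ) (u ux : ℝ → ℝ → ℝ) (P : ℝ → ℝ → ℝ)
    (hp : ∀ t < tstar, p t =
      D * (1 + Real.exp (2 * D * (t - tstar))) / (1 - Real.exp (2 * D * (t - tstar))))
    (hq : ∀ t < tstar, q t =
      Real.log (2 * Real.exp (D * (t - tstar)) / (1 + Real.exp (2 * D * (t - tstar)))))
    (hu : ∀ t < tstar, ∀ x : ℝ,
      u t x = p t * (Real.exp (-|x - q t|) - Real.exp (-|x + q t|)))
    (hux : ∀ t < tstar, ∀ᵐ x : ℝ, HasDerivAt (u t) (ux t x) x)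
    (hP : ∀ t < tstar, ∀ x : ℝ,
      P t x = (1 / 4) * ∫ y : ℝ, Real.exp (-|x - y|) * (2 * u t y ^ 2 + ux t y ^ 2)) :
    ∀ x : ℝ, Tendsto (fun t => P t x) (nhdsWithin tstar (Set.Iio tstar))
      (nhds (D ^ 2 * Real.exp (-|x|))) := by
  intro x
  have hE (t : ℝ) : Real.exp (2 * D * (t - tstar)) = Real.exp (D * (t - tstar)) ^ 2 := by
    rw [← Real.exp_nat_mul]; push_cast; ring_nf
  have hE1 (t : ℝ) (ht : t < tstar) : Real.exp (D * (t - tstar)) < 1 :=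
    Real.exp_lt_one_iff.2 (mul_neg_of_pos_of_neg hD (sub_neg.2 ht))
  have hqneg (t : ℝ) (ht : t < tstar) : q t < 0 := by
    have := hE1 t ht
    rw [hq t ht, hE]
    refine Real.log_neg (by positivity) ((div_lt_one (by positivity)).2 ?_)
    nlinarith [mul_pos (sub_pos.2 this) (sub_pos.2 this)]
  have hexpq (t : ℝ) (ht : t < tstar) : Real.exp (q t) =
      2 * Real.exp (D * (t - tstar)) / (1 + Real.exp (2 * D * (t - tstar))) := by
    rw [hq t ht, Real.exp_log (by positivity)]
  have hexp2 (z : ℝ) : Real.exp (2 * z) = Real.exp z ^ 2 := by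
    rw [← Real.exp_nat_mul]; push_cast; ring_nf
  have hpq (t : ℝ) (ht : t < tstar) : p t ^ 2 * (1 - Real.exp (2 * q t)) = D ^ 2 := by
    have h1 := hE1 t ht
    have h0 := Real.exp_pos (D * (t - tstar))
    rw [hexp2, hexpq t ht, hp t ht, hE]
    have h2 : 1 - Real.exp (D * (t - tstar)) ^ 2 ≠ 0 := by nlinarith
    have h3 : 1 + Real.exp (D * (t - tstar)) ^ 2 ≠ 0 := by positivity
    field_simp
    ring
  have hqlim : Tendsto q (𝓝[<] tstar) (𝓝[<] 0) := by
    refine tendsto_nhdsWithin_iff.2 ⟨?_, ?_⟩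
    · have hc : ContinuousAt (fun t => Real.log (2 * Real.exp (D * (t - tstar)) /
          (1 + Real.exp (2 * D * (t - tstar))))) tstar := by
        refine ContinuousAt.log (ContinuousAt.div (by fun_prop) (by fun_prop) (by positivity)) ?_
        positivity
      have h1 := hc.tendsto.mono_left (nhdsWithin_le_nhds (s := Set.Iio tstar))
      have h2 : Real.log (2 * Real.exp (D * (tstar - tstar)) /
          (1 + Real.exp (2 * D * (tstar - tstar)))) = 0 := by
        norm_num
      rw [h2] at h1
      refine h1.congr' ?_
      filter_upwards [self_mem_nhdsWithin] with t ht using (hq t ht).symm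
    · filter_upwards [self_mem_nhdsWithin] with t ht using hqneg t ht
  set h : ℝ → ℝ := fun y => Real.exp (-|x - y|) *
    (3 * Real.exp (2 * y) + 3 * Real.exp (-2 * y) - 2) with hh
  set K : ℝ → ℝ := fun y => Real.exp (-|x - y|) * Real.exp (-2 * |y|) with hK
  have hKint : Integrable K := integrable_exp_neg_abs_sub_mul_exp_neg_two_mul_abs x
  have hK0 (y : ℝ) : 0 ≤ K y := by positivity
  have houter : Tendsto (fun r => 3 * D ^ 2 * Real.exp (-(2 * r)) * (1 - Real.exp (2 * r)) *
      ∫ y in (Set.Ioc r (-r))ᶜ, K y) (𝓝[<] 0) (𝓝 0) := by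
    refine Tendsto.zero_mul_isBoundedUnder_le ?_ ?_
    · have hc : Continuous fun r : ℝ =>
          3 * D ^ 2 * Real.exp (-(2 * r)) * (1 - Real.exp (2 * r)) := by fun_prop
      simpa using (hc.tendsto 0).mono_left (nhdsWithin_le_nhds (s := Set.Iio 0))
    · refine isBoundedUnder_of ⟨∫ y, K y, fun r => ?_⟩
      rw [Function.comp_apply, Real.norm_of_nonneg (integral_nonneg hK0)]
      exact setIntegral_le_integral hKint (ae_of_all _ hK0)
  have hinner : Tendsto (fun r => D ^ 2 * Real.exp (2 * r) *
      ((∫ y in r..-r, h y) / (1 - Real.exp (2 * r)))) (𝓝[<] 0)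
      (𝓝 (D ^ 2 * Real.exp (2 * 0) * h 0)) := by
    have hc : Continuous fun r : ℝ => D ^ 2 * Real.exp (2 * r) := by fun_prop
    exact ((hc.tendsto 0).mono_left nhdsWithin_le_nhds).mul
      (tendsto_integral_symm_div_one_sub_exp (by fun_prop))
  have hlim := ((hinner.add houter).const_mul (1 / 4)).comp hqlim
  have hval : 1 / 4 * (D ^ 2 * Real.exp (2 * 0) * h 0 + 0) = D ^ 2 * Real.exp (-|x|) := by
    simp only [hh, mul_zero, Real.exp_zero, sub_zero]
    ring
  rw [hval] at hlim
  refine hlim.congr' ?_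
  filter_upwards [self_mem_nhdsWithin] with t ht
  have hne : 1 - Real.exp (2 * q t) ≠ 0 :=
    (sub_pos.2 (Real.exp_lt_one_iff.2 (by linarith [hqneg t ht]))).ne'
  rw [hP t ht x, integral_peakon_antipeakon x (p t) (q t) (hqneg t ht) (u t) (ux t) (hu t ht)
    (hux t ht)]
  simp only [Function.comp_apply, ← hpq t ht]
  have e1 : Real.exp (-(2 * q t)) = (Real.exp (q t))⁻¹ ^ 2 := by
    rw [← Real.exp_neg, ← hexp2]; ring_nf
  have e2 : p t ^ 2 * (1 - Real.exp (2 * q t)) * Real.exp (2 * q t) *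
      ((∫ y in q t..-q t, h y) / (1 - Real.exp (2 * q t))) =
      p t ^ 2 * Real.exp (2 * q t) * ∫ y in q t..-q t, h y := by
    field_simp
  have e3 : 3 * (p t ^ 2 * (1 - Real.exp (2 * q t))) * Real.exp (-(2 * q t)) *
      (1 - Real.exp (2 * q t)) = 3 * p t ^ 2 * (Real.exp (q t) - Real.exp (-q t)) ^ 2 := by
    rw [e1, hexp2, Real.exp_neg]
    have := (Real.exp_pos (q t)).ne'
    field_simp
    ring
  rw [e2, e3]
end
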